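/- liminf_{n→∞} φ(σ*(n)) · log log n / n = e^{−γ}, where γ is the Euler–Mascheroni constant. -/

import Mathlib

open Filter Real

/-- The sum of the unitary divisors of `n`: `σ*(p₁^{a₁} ⋯ p_r^{a_r}) = ∏ (p_i^{a_i} + 1)`. -/
def usigma (n : ℕ) : ℕ := n.factorization.prod fun p a => p ^ a + 1

theorem log_factorial_eq_sum_primesLE (n : ℕ) :
    Real.log (n.factorial : ℝ) =
      ∑ p ∈ n.primesLE, (n.factorial.factorization p : ℝ) * Real.log p := by
  rw [Real.log_nat_eq_sum_factorization, Finsupp.sum]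
  refine Finset.sum_subset (fun p hp => ?_) (fun p _ hp => ?_)
  · rw [Nat.support_factorization, Nat.mem_primeFactors] at hp
    exact Nat.mem_primesLE.2 ⟨(hp.1.dvd_factorial).1 hp.2.1, hp.1⟩
  · simp [Finsupp.notMem_support_iff.1 hp]

theorem sum_log_div_primesLE_le {n : ℕ} (hn : 1 ≤ n) :
    ∑ p ∈ n.primesLE, Real.log p / p ≤ Real.log n + Real.log 4 := by
  have hn0 : (0 : ℝ) < n := by exact_mod_cast hn
  have h1 : Real.log (n.factorial : ℝ) ≤ n * Real.log n := by
    rw [← Real.log_pow]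
    exact Real.log_le_log (by positivity) (by exact_mod_cast Nat.factorial_le_pow n)
  have h2 : ∑ p ∈ n.primesLE, ((n : ℝ) / p - 1) * Real.log p ≤ Real.log (n.factorial : ℝ) := by
    rw [log_factorial_eq_sum_primesLE]
    refine Finset.sum_le_sum fun p hp => ?_
    have hp' := Nat.prime_of_mem_primesLE hp
    have hp0 : (0 : ℝ) < p := by exact_mod_cast hp'.pos
    refine mul_le_mul_of_nonneg_right ?_ (Real.log_natCast_nonneg p)
    have h3 : n / p ≤ n.factorial.factorization p := by
      have h4 := Nat.factorization_factorial_mul (n := n / p) hp'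
      have h5 : (p * (n / p)).factorial ∣ n.factorial :=
        Nat.factorial_dvd_factorial (Nat.mul_div_le n p)
      have h6 := (Nat.factorization_le_iff_dvd (Nat.factorial_ne_zero _)
        (Nat.factorial_ne_zero _)).2 h5 p
      omega
    have h4 : (n : ℝ) / p < (n / p : ℕ) + 1 := by
      rw [div_lt_iff₀ hp0]
      have := Nat.lt_mul_div_succ n hp'.pos
      rw [mul_comm]
      exact_mod_cast this
    have h5 : ((n / p : ℕ) : ℝ) ≤ n.factorial.factorization p := by exact_mod_cast h3
    linarith
  have h3 : ∑ p ∈ n.primesLE, ((n : ℝ) / p - 1) * Real.log p =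
      n * ∑ p ∈ n.primesLE, Real.log p / p - Chebyshev.theta n := by
    rw [Chebyshev.theta_eq_sum_primesLE_log, Finset.mul_sum, ← Finset.sum_sub_distrib]
    exact Finset.sum_congr rfl fun p _ => by ring
  have h4 := Chebyshev.theta_le_log4_mul_x hn0.le
  have h5 : n * ∑ p ∈ n.primesLE, Real.log p / p ≤ n * (Real.log n + Real.log 4) := by
    linarith
  exact le_of_mul_le_mul_left h5 hn0

theorem exists_sum_log_div_primesLE_ge :
    ∃ C : ℝ, ∀ n : ℕ, 1 ≤ n → Real.log n - C ≤ ∑ p ∈ n.primesLE, Real.log p / p := by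
  have hs : Summable fun n : ℕ => 4 * (n : ℝ) ^ (-(3 / 2) : ℝ) :=
    (Real.summable_nat_rpow.2 (by norm_num)).mul_left 4
  refine ⟨1 + ∑' n : ℕ, 4 * (n : ℝ) ^ (-(3 / 2) : ℝ), fun n hn => ?_⟩
  have hn0 : (0 : ℝ) < n := by exact_mod_cast hn
  have h1 : n * (Real.log n - 1) ≤ Real.log (n.factorial : ℝ) := by
    have h := Stirling.le_log_factorial_stirling (n := n) (by omega)
    have h2 : 0 ≤ Real.log n := Real.log_natCast_nonneg n
    have h3 : 0 ≤ Real.log (2 * π) :=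
      Real.log_nonneg (by linarith [Real.pi_gt_three])
    linarith
  have h2 : Real.log (n.factorial : ℝ) ≤
      n * ∑ p ∈ n.primesLE, (Real.log p / p + 4 * (p : ℝ) ^ (-(3 / 2) : ℝ)) := by
    rw [log_factorial_eq_sum_primesLE, Finset.mul_sum]
    refine Finset.sum_le_sum fun p hp => ?_
    have hp' := Nat.prime_of_mem_primesLE hp
    have hp2 : (2 : ℝ) ≤ p := by exact_mod_cast hp'.two_le
    have hp0 : (0 : ℝ) < p := by linarith
    have h3 : (n.factorial.factorization p : ℝ) ≤ n / (p - 1) := by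
      have h3 := Nat.factorization_factorial_le_div_pred hp' n
      calc (n.factorial.factorization p : ℝ) ≤ ((n / (p - 1) : ℕ) : ℝ) := by exact_mod_cast h3
        _ ≤ (n : ℝ) / ((p - 1 : ℕ) : ℝ) := Nat.cast_div_le
        _ = n / (p - 1) := by rw [Nat.cast_sub hp'.one_le, Nat.cast_one]
    have h4 : Real.log p ≤ 2 * (p : ℝ) ^ (1 / 2 : ℝ) := by
      have := Real.log_le_rpow_div hp0.le (ε := 1 / 2) (by norm_num)
      linarith
    have h5 : (p : ℝ) ^ (-(3 / 2) : ℝ) = (p : ℝ) ^ (1 / 2 : ℝ) / p ^ 2 := by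
      rw [← Real.rpow_natCast, ← Real.rpow_sub hp0]
      norm_num
    calc (n.factorial.factorization p : ℝ) * Real.log p
        ≤ n / (p - 1) * Real.log p :=
          mul_le_mul_of_nonneg_right h3 (Real.log_natCast_nonneg p)
      _ = n * (Real.log p / p + Real.log p / (p * (p - 1))) := by
          have : (p : ℝ) - 1 ≠ 0 := by linarith
          field_simp
          ring
      _ ≤ n * (Real.log p / p + 4 * (p : ℝ) ^ (-(3 / 2) : ℝ)) := by
          refine mul_le_mul_of_nonneg_left (add_le_add le_rfl ?_) hn0.le
          rw [h5, div_le_iff₀ (by nlinarith)]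
          have h6 : (1 : ℝ) ≤ 2 * (p - 1) / p := by
            rw [le_div_iff₀ hp0]; linarith
          calc Real.log p ≤ 2 * (p : ℝ) ^ (1 / 2 : ℝ) * 1 := by linarith
            _ ≤ 2 * (p : ℝ) ^ (1 / 2 : ℝ) * (2 * (p - 1) / p) :=
                mul_le_mul_of_nonneg_left h6 (by positivity)
            _ = _ := by field_simp; ring
  have h3 : Real.log n - 1 ≤
      ∑ p ∈ n.primesLE, (Real.log p / p + 4 * (p : ℝ) ^ (-(3 / 2) : ℝ)) :=
    le_of_mul_le_mul_left (h1.trans h2) hn0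
  rw [Finset.sum_add_distrib] at h3
  have h4 := hs.sum_le_tsum n.primesLE (fun i _ => by positivity)
  linarith

theorem exists_abs_sum_log_div_sub_log_le :
    ∃ C : ℝ, ∀ x : ℝ, 1 ≤ x → |∑ p ∈ ⌊x⌋₊.primesLE, Real.log p / p - Real.log x| ≤ C := by
  obtain ⟨C, hC⟩ := exists_sum_log_div_primesLE_ge
  refine ⟨|C| + 2, fun x hx => ?_⟩
  have hn : 1 ≤ ⌊x⌋₊ := (Nat.one_le_floor_iff x).2 hx
  have hn0 : (1 : ℝ) ≤ ⌊x⌋₊ := by exact_mod_cast hn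
  have h1 := hC _ hn
  have h2 := sum_log_div_primesLE_le hn
  have h3 : Real.log ⌊x⌋₊ ≤ Real.log x :=
    Real.log_le_log (by linarith) (Nat.floor_le (by linarith))
  have h4 : Real.log x ≤ Real.log ⌊x⌋₊ + Real.log 2 := by
    rw [← Real.log_mul (by linarith) (by norm_num)]
    exact Real.log_le_log (by linarith) (by linarith [Nat.lt_floor_add_one x])
  have h5 : Real.log 4 = 2 * Real.log 2 := by
    rw [show (4 : ℝ) = 2 ^ 2 by norm_num, Real.log_pow]; norm_num
  have h6 := Real.log_two_lt_d9
  have h7 := le_abs_self C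
  have h8 := abs_nonneg C
  rw [abs_le]
  constructor <;> linarith

theorem sum_one_div_primesLE_sub_eq_integral {a b : ℝ} (ha : 2 ≤ a) (hab : a ≤ b) :
    ∑ p ∈ ⌊b⌋₊.primesLE, (1 : ℝ) / p - ∑ p ∈ ⌊a⌋₊.primesLE, (1 : ℝ) / p =
      (Real.log b)⁻¹ * ∑ p ∈ ⌊b⌋₊.primesLE, Real.log p / p -
      (Real.log a)⁻¹ * ∑ p ∈ ⌊a⌋₊.primesLE, Real.log p / p -
      ∫ t in a..b, -t⁻¹ / Real.log t ^ 2 * ∑ p ∈ ⌊t⌋₊.primesLE, Real.log p / p := by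
  have hlog : ∀ t ∈ Set.Icc a b, 0 < Real.log t := fun t ht => Real.log_pos (by linarith [ht.1])
  have hd : ∀ t ∈ Set.Icc a b,
      HasDerivAt (fun t => (Real.log t)⁻¹) (-t⁻¹ / Real.log t ^ 2) t := fun t ht =>
    (Real.hasDerivAt_log (by linarith [ht.1])).inv (hlog t ht).ne'
  have hc : ContinuousOn (fun t : ℝ => -t⁻¹ / Real.log t ^ 2) (Set.Icc a b) := by
    refine ContinuousOn.div (ContinuousOn.neg (continuousOn_id.inv₀ fun t ht => ?_))
      ((Real.continuousOn_log.mono fun t ht => ?_).pow 2) fun t ht => ?_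
    · have := ht.1; simp only [id]; linarith
    · have := ht.1
      simp only [Set.mem_compl_iff, Set.mem_singleton_iff]; linarith
    · exact pow_ne_zero 2 (hlog t ht).ne'
  have hA : ∀ n : ℕ, ∑ k ∈ Finset.Icc 0 n, (if k.Prime then Real.log k / k else 0) =
      ∑ p ∈ n.primesLE, Real.log p / p := fun n => by
    rw [Nat.primesLE_eq_filter_Icc_zero, Finset.sum_filter]
  have key := sum_mul_eq_sub_sub_integral_mul
    (fun k : ℕ => if k.Prime then Real.log k / k else 0) (by linarith : 0 ≤ a) hab
    (f := fun t => (Real.log t)⁻¹) (fun t ht => (hd t ht).differentiableAt)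
    ((hc.congr fun t ht => (hd t ht).deriv).integrableOn_Icc)
  simp only [hA] at key
  rw [intervalIntegral.integral_of_le hab]
  have h1 : ∫ t in Set.Ioc a b, -t⁻¹ / Real.log t ^ 2 * ∑ p ∈ ⌊t⌋₊.primesLE, Real.log p / p =
      ∫ t in Set.Ioc a b, deriv (fun t => (Real.log t)⁻¹) t *
        ∑ p ∈ ⌊t⌋₊.primesLE, Real.log p / p :=
    MeasureTheory.setIntegral_congr_fun measurableSet_Ioc fun t ht => by
      simp only [(hd t (Set.Ioc_subset_Icc_self ht)).deriv]
  rw [h1, ← key]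
  have h2 : ∀ n : ℕ, ∑ p ∈ n.primesLE, (1 : ℝ) / p =
      ∑ k ∈ Finset.Ioc 0 n, (if k.Prime then (1 : ℝ) / k else 0) := fun n => by
    rw [Nat.primesLE_eq_filter_Ioc_zero, Finset.sum_filter]
  rw [h2, h2, ← Finset.sum_Ioc_consecutive _ (Nat.zero_le _) (Nat.floor_le_floor hab),
    add_sub_cancel_left]
  refine Finset.sum_congr rfl fun k _ => ?_
  split_ifs with hk
  · have : Real.log k ≠ 0 := (Real.log_pos (by exact_mod_cast hk.one_lt)).ne'
    field_simp
  · simp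

theorem exists_abs_sum_one_div_primesLE_sub_le :
    ∃ C : ℝ, 0 ≤ C ∧ ∀ a b : ℝ, 2 ≤ a → a ≤ b →
      |(∑ p ∈ ⌊b⌋₊.primesLE, (1 : ℝ) / p - Real.log (Real.log b)) -
        (∑ p ∈ ⌊a⌋₊.primesLE, (1 : ℝ) / p - Real.log (Real.log a))| ≤ C / Real.log a := by
  obtain ⟨C, hC⟩ := exists_abs_sum_log_div_sub_log_le
  have hC0 : 0 ≤ C := (abs_nonneg _).trans (hC 1 le_rfl)
  refine ⟨2 * C, by positivity, fun a b ha hab => ?_⟩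
  have hlog : ∀ t ∈ Set.Icc a b, 0 < Real.log t := fun t ht => Real.log_pos (by linarith [ht.1])
  have hla := hlog a ⟨le_rfl, hab⟩
  have hlb := hlog b ⟨hab, le_rfl⟩
  have huIcc : Set.uIcc a b = Set.Icc a b := Set.uIcc_of_le hab
  have hd : ∀ t ∈ Set.uIcc a b,
      HasDerivAt (fun t => (Real.log t)⁻¹) (-t⁻¹ / Real.log t ^ 2) t := fun t ht => by
    rw [huIcc] at ht
    exact (Real.hasDerivAt_log (by linarith [ht.1])).inv (hlog t ht).ne'
  have hc : ContinuousOn (fun t : ℝ => -t⁻¹ / Real.log t ^ 2) (Set.Icc a b) := by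
    refine ContinuousOn.div (ContinuousOn.neg (continuousOn_id.inv₀ fun t ht => ?_))
      ((Real.continuousOn_log.mono fun t ht => ?_).pow 2) fun t ht => ?_
    · have := ht.1; simp only [id]; linarith
    · have := ht.1
      simp only [Set.mem_compl_iff, Set.mem_singleton_iff]; linarith
    · exact pow_ne_zero 2 (hlog t ht).ne'
  have hd2 : ∀ t ∈ Set.uIcc a b,
      HasDerivAt (fun t => Real.log (Real.log t)) (t⁻¹ / Real.log t) t := fun t ht => by
    rw [huIcc] at ht
    exact (Real.hasDerivAt_log (by linarith [ht.1])).log (hlog t ht).ne'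
  have hc2 : ContinuousOn (fun t : ℝ => t⁻¹ / Real.log t) (Set.Icc a b) := by
    refine ContinuousOn.div (continuousOn_id.inv₀ fun t ht => ?_)
      (Real.continuousOn_log.mono fun t ht => ?_) fun t ht => ?_
    · have := ht.1; simp only [id]; linarith
    · have := ht.1
      simp only [Set.mem_compl_iff, Set.mem_singleton_iff]; linarith
    · exact (hlog t ht).ne'
  have hi := hc.intervalIntegrable_of_Icc (μ := MeasureTheory.volume) hab
  have hi2 := hc2.intervalIntegrable_of_Icc (μ := MeasureTheory.volume) hab
  have e1 := intervalIntegral.integral_eq_sub_of_hasDerivAt hd hi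
  have e2 := intervalIntegral.integral_eq_sub_of_hasDerivAt hd2 hi2
  have hiA : IntervalIntegrable (fun t => -t⁻¹ / Real.log t ^ 2 *
      ∑ p ∈ ⌊t⌋₊.primesLE, Real.log p / p) MeasureTheory.volume a b := by
    have h := integrableOn_mul_sum_Icc (m := 0)
      (fun k : ℕ => if k.Prime then Real.log k / k else 0) (by linarith : 0 ≤ a)
      hc.integrableOn_Icc
    rw [intervalIntegrable_iff_integrableOn_Icc_of_le hab]
    refine h.congr_fun (fun t _ => ?_) measurableSet_Icc
    simp only [Nat.primesLE_eq_filter_Icc_zero, Finset.sum_filter]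
  have e3 : (∫ t in a..b, -t⁻¹ / Real.log t ^ 2 * ∑ p ∈ ⌊t⌋₊.primesLE, Real.log p / p) +
      ∫ t in a..b, t⁻¹ / Real.log t = ∫ t in a..b, -t⁻¹ / Real.log t ^ 2 *
        (∑ p ∈ ⌊t⌋₊.primesLE, Real.log p / p - Real.log t) := by
    rw [← intervalIntegral.integral_add hiA hi2]
    refine intervalIntegral.integral_congr fun t ht => ?_
    rw [huIcc] at ht
    have := (hlog t ht).ne'
    field_simp
    ring
  have e4 : |∫ t in a..b, -t⁻¹ / Real.log t ^ 2 *
      (∑ p ∈ ⌊t⌋₊.primesLE, Real.log p / p - Real.log t)| ≤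
      ∫ t in a..b, -C * (-t⁻¹ / Real.log t ^ 2) := by
    rw [← Real.norm_eq_abs]
    refine intervalIntegral.norm_integral_le_of_norm_le hab ?_ (hi.const_mul _)
    refine Eventually.of_forall fun t ht => ?_
    have ht0 : 0 < t := by linarith [ht.1]
    have h1 := hC t (by linarith [ht.1])
    have h2 : 0 ≤ t⁻¹ / Real.log t ^ 2 := by positivity
    rw [Real.norm_eq_abs, abs_mul, neg_div, abs_neg, abs_of_nonneg h2]
    nlinarith
  rw [intervalIntegral.integral_const_mul, e1] at e4
  have key := sum_one_div_primesLE_sub_eq_integral ha hab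
  rw [e2] at e3
  have ea := hC a (by linarith)
  have eb := hC b (by linarith)
  set Aa := ∑ p ∈ ⌊a⌋₊.primesLE, Real.log p / p
  set Ab := ∑ p ∈ ⌊b⌋₊.primesLE, Real.log p / p
  have e5 : |(Real.log b)⁻¹ * (Ab - Real.log b)| ≤ C * (Real.log b)⁻¹ := by
    rw [abs_mul, abs_of_pos (inv_pos.2 hlb), mul_comm]
    exact mul_le_mul_of_nonneg_right eb (inv_pos.2 hlb).le
  have e6 : |(Real.log a)⁻¹ * (Aa - Real.log a)| ≤ C * (Real.log a)⁻¹ := by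
    rw [abs_mul, abs_of_pos (inv_pos.2 hla), mul_comm]
    exact mul_le_mul_of_nonneg_right ea (inv_pos.2 hla).le
  rw [mul_sub, inv_mul_cancel₀ hlb.ne'] at e5
  rw [mul_sub, inv_mul_cancel₀ hla.ne'] at e6
  rw [div_eq_mul_inv]
  rw [abs_le] at *
  constructor <;> linarith [e4.1, e4.2, e5.1, e5.2, e6.1, e6.2]

/-- **Mertens' second theorem**. -/
theorem exists_abs_sum_one_div_primesLE_sub_log_log_le :
    ∃ M C : ℝ, 0 ≤ C ∧ ∀ x : ℝ, 2 ≤ x →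
      |∑ p ∈ ⌊x⌋₊.primesLE, (1 : ℝ) / p - Real.log (Real.log x) - M| ≤ C / Real.log x := by
  obtain ⟨C, hC0, hC⟩ := exists_abs_sum_one_div_primesLE_sub_le
  set E : ℝ → ℝ := fun x => ∑ p ∈ ⌊x⌋₊.primesLE, (1 : ℝ) / p - Real.log (Real.log x) with hE
  have hlim : Tendsto (fun x => C / Real.log (max x 2)) atTop (nhds 0) :=
    tendsto_const_nhds.div_atTop (Real.tendsto_log_atTop.comp
      (tendsto_atTop_mono (fun x => le_max_left x 2) tendsto_id))
  have hcauchy : CauchySeq fun x : ℝ => E (max x 2) := by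
    have hlim2 : Tendsto (fun x => C / Real.log (max x 2) + C / Real.log (max x 2)) atTop
        (nhds 0) := by simpa using hlim.add hlim
    refine cauchySeq_of_le_tendsto_0 _ (fun n m N hn hm => ?_) hlim2
    have h1 := hC (max N 2) (max n 2) (le_max_right _ _) (max_le_max_right 2 hn)
    have h2 := hC (max N 2) (max m 2) (le_max_right _ _) (max_le_max_right 2 hm)
    rw [Real.dist_eq]
    simp only [hE]
    rw [abs_le] at *
    constructor <;> linarith [h1.1, h1.2, h2.1, h2.2]
  obtain ⟨M, hM⟩ := cauchySeq_tendsto_of_complete hcauchy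
  refine ⟨M, C, hC0, fun x hx => ?_⟩
  rw [abs_sub_comm]
  refine le_of_tendsto ((hM.sub_const (E x)).abs) ?_
  filter_upwards [eventually_ge_atTop x] with b hb
  rw [max_eq_left (hx.trans hb)]
  exact hC x b hx hb

theorem integrableOn_exp_neg_mul_ite (c w : ℝ) :
    MeasureTheory.IntegrableOn (fun u : ℝ => Real.exp (-u) * if c ≤ u then w else 0)
      (Set.Ioi 0) := by
  refine MeasureTheory.Integrable.mono' ((integrableOn_exp_neg_Ioi 0).mul_const |w|) ?_ ?_
  · refine Measurable.aestronglyMeasurable ?_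
    exact (by fun_prop : Measurable fun u : ℝ => Real.exp (-u)).mul
      (Measurable.ite measurableSet_Ici measurable_const measurable_const)
  · refine Eventually.of_forall fun u => ?_
    rw [Real.norm_eq_abs, abs_mul, Real.abs_exp]
    refine mul_le_mul_of_nonneg_left ?_ (Real.exp_pos _).le
    split_ifs
    · exact le_rfl
    · simp

theorem integral_exp_neg_mul_ite {c : ℝ} (hc : 0 ≤ c) (w : ℝ) :
    ∫ u in Set.Ioi (0 : ℝ), Real.exp (-u) * (if c ≤ u then w else 0) = w * Real.exp (-c) := by
  have h : ∀ u ∈ Set.Ioi (0 : ℝ), Real.exp (-u) * (if c ≤ u then w else 0) =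
      (Set.Ici c).indicator (fun u => w * Real.exp (-u)) u := fun u _ => by
    by_cases h : c ≤ u <;> simp [h, mul_comm]
  rw [MeasureTheory.setIntegral_congr_fun measurableSet_Ioi h,
    MeasureTheory.setIntegral_indicator measurableSet_Ici]
  have h2 : ∫ u in Set.Ioi (0 : ℝ) ∩ Set.Ici c, w * Real.exp (-u) =
      ∫ u in Set.Ioi c, w * Real.exp (-u) := by
    rcases hc.eq_or_lt with rfl | hc
    · rw [Set.inter_eq_left.2 Set.Ioi_subset_Ici_self]
    · rw [Set.inter_eq_right.2 (Set.Ici_subset_Ioi.2 hc),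
          MeasureTheory.integral_Ici_eq_integral_Ioi]
  rw [h2, MeasureTheory.integral_const_mul, integral_exp_neg_Ioi]

theorem tendsto_tsum_mul_exp_log_sub {a b : ℕ → ℝ} (ha : ∀ n, 0 ≤ a n) (hb : ∀ n, 0 ≤ b n)
    (hsa : ∀ δ > 0, Summable fun n : ℕ => a n * Real.exp (-(δ * Real.log n)))
    (hsb : ∀ δ > 0, Summable fun n : ℕ => b n * Real.exp (-(δ * n))) {c : ℝ}
    (hD : Tendsto (fun t : ℝ => ∑ n ∈ Finset.range (⌊Real.exp t⌋₊ + 1), a n -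
      ∑ n ∈ Finset.range (⌊t⌋₊ + 1), b n) atTop (nhds c)) :
    Tendsto (fun δ : ℝ => ∑' n : ℕ, a n * Real.exp (-(δ * Real.log n)) -
      ∑' n : ℕ, b n * Real.exp (-(δ * n))) (nhdsWithin 0 (Set.Ioi 0)) (nhds c) := by
  set D : ℝ → ℝ := fun t => ∑ n ∈ Finset.range (⌊Real.exp t⌋₊ + 1), a n -
      ∑ n ∈ Finset.range (⌊t⌋₊ + 1), b n with hDdef
  have hmeas : Measurable D := by
    refine Measurable.sub ?_ ?_
    · exact (measurable_from_nat (f := fun N => ∑ n ∈ Finset.range (N + 1), a n)).comp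
        (Nat.measurable_floor.comp Real.measurable_exp)
    · exact (measurable_from_nat (f := fun N => ∑ n ∈ Finset.range (N + 1), b n)).comp
        Nat.measurable_floor
  obtain ⟨K, hK⟩ : ∃ K, ∀ t, |D t| ≤ K := by
    obtain ⟨T, hT⟩ := eventually_atTop.1 ((tendsto_order.1 hD.abs).2 _ (lt_add_one |c|))
    refine ⟨max (|c| + 1) (∑ n ∈ Finset.range (⌊Real.exp T⌋₊ + 1), a n +
      ∑ n ∈ Finset.range (⌊T⌋₊ + 1), b n), fun t => ?_⟩
    rcases le_total T t with h | h
    · exact (hT t h).le.trans (le_max_left _ _)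
    · refine le_trans ?_ (le_max_right _ _)
      refine (abs_sub _ _).trans ?_
      rw [abs_of_nonneg (Finset.sum_nonneg fun n _ => ha n),
        abs_of_nonneg (Finset.sum_nonneg fun n _ => hb n)]
      gcongr
      · exact fun n _ _ => ha n
      · exact fun n _ _ => hb n
  have hasInt : ∀ δ ∈ Set.Ioi (0 : ℝ), (∑' n : ℕ, a n * Real.exp (-(δ * Real.log n)) -
      ∑' n : ℕ, b n * Real.exp (-(δ * n))) = ∫ u in Set.Ioi (0 : ℝ), Real.exp (-u) * D (u / δ) := by
    intro δ hδ
    have hδ0 : (0 : ℝ) < δ := hδ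
    rw [← (hsa δ hδ).tsum_sub (hsb δ hδ)]
    have hI : ∀ n : ℕ, MeasureTheory.IntegrableOn (fun u : ℝ =>
        (Real.exp (-u) * if δ * Real.log n ≤ u then a n else 0) -
        Real.exp (-u) * if δ * n ≤ u then b n else 0) (Set.Ioi 0) := fun n =>
      (integrableOn_exp_neg_mul_ite _ _).sub (integrableOn_exp_neg_mul_ite _ _)
    have hln : ∀ n : ℕ, 0 ≤ δ * Real.log n := fun n =>
      mul_nonneg hδ0.le (Real.log_natCast_nonneg n)
    have hS := MeasureTheory.hasSum_integral_of_summable_integral_norm hI (by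
      refine ((hsa δ hδ).add (hsb δ hδ)).of_nonneg_of_le
        (fun n => MeasureTheory.integral_nonneg fun u => norm_nonneg _) fun n => ?_
      rw [← integral_exp_neg_mul_ite (hln n),
          ← integral_exp_neg_mul_ite (by positivity : 0 ≤ δ * n),
        ← MeasureTheory.integral_add (integrableOn_exp_neg_mul_ite _ _)
          (integrableOn_exp_neg_mul_ite _ _)]
      refine MeasureTheory.integral_mono (hI n).norm ((integrableOn_exp_neg_mul_ite _ _).add
          (integrableOn_exp_neg_mul_ite _ _)) fun u => ?_
      refine (abs_sub _ _).trans (le_of_eq ?_)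
      have := ha n
      have := hb n
      rw [abs_of_nonneg (mul_nonneg (Real.exp_pos _).le (by split_ifs <;> simp [*])),
        abs_of_nonneg (mul_nonneg (Real.exp_pos _).le (by split_ifs <;> simp [*]))])
    have hterm : ∀ n : ℕ, (∫ u in Set.Ioi (0 : ℝ),
        ((Real.exp (-u) * if δ * Real.log n ≤ u then a n else 0) -
        Real.exp (-u) * if δ * n ≤ u then b n else 0)) =
        a n * Real.exp (-(δ * Real.log n)) - b n * Real.exp (-(δ * n)) := fun n => by
      rw [MeasureTheory.integral_sub (integrableOn_exp_neg_mul_ite _ _)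
        (integrableOn_exp_neg_mul_ite _ _), integral_exp_neg_mul_ite (hln n),
        integral_exp_neg_mul_ite (by positivity)]
    simp only [hterm] at hS
    rw [hS.tsum_eq]
    refine MeasureTheory.setIntegral_congr_fun measurableSet_Ioi fun u hu => ?_
    have hu0 : (0 : ℝ) < u := hu
    have hsum : ∀ (N : ℕ) (f : ℕ → ℝ) (P : ℕ → Prop) [DecidablePred P], (∀ n, P n ↔ n ≤ N) →
        HasSum (fun n => Real.exp (-u) * if P n then f n else 0)
          (Real.exp (-u) * ∑ n ∈ Finset.range (N + 1), f n) := by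
      intro N f P _ hP
      refine HasSum.mul_left _ ?_
      have hf : ∑ n ∈ Finset.range (N + 1), f n =
          ∑ n ∈ Finset.range (N + 1), if P n then f n else 0 :=
        Finset.sum_congr rfl fun n hn => by
          rw [Finset.mem_range, Nat.lt_succ_iff, ← hP] at hn; simp [hn]
      rw [hf]
      exact hasSum_sum_of_ne_finset_zero fun n hn => by
        rw [Finset.mem_range, Nat.lt_succ_iff, ← hP] at hn; simp [hn]
    have h1 := hsum ⌊Real.exp (u / δ)⌋₊ a (fun n => δ * Real.log n ≤ u) fun n => by
      rw [Nat.le_floor_iff (Real.exp_pos _).le]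
      rcases n.eq_zero_or_pos with rfl | hn
      · simp [hu0.le, (Real.exp_pos _).le]
      · rw [← Real.log_le_iff_le_exp (by exact_mod_cast hn), le_div_iff₀' hδ0]
    have h2 := hsum ⌊u / δ⌋₊ b (fun n => δ * n ≤ u) fun n => by
      rw [Nat.le_floor_iff (by positivity), le_div_iff₀' hδ0]
    rw [(h1.sub h2).tsum_eq, hDdef]
    ring
  have hlim : Tendsto (fun δ => ∫ u in Set.Ioi (0 : ℝ), Real.exp (-u) * D (u / δ))
      (nhdsWithin 0 (Set.Ioi 0)) (nhds (∫ u in Set.Ioi (0 : ℝ), Real.exp (-u) * c)) := by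
    refine MeasureTheory.tendsto_integral_filter_of_dominated_convergence
      (fun u => Real.exp (-u) * K) ?_ ?_ ((integrableOn_exp_neg_Ioi 0).mul_const K) ?_
    · refine Eventually.of_forall fun δ => Measurable.aestronglyMeasurable ?_
      exact (by fun_prop : Measurable fun u : ℝ => Real.exp (-u)).mul
        (hmeas.comp (measurable_id.div_const δ))
    · refine Eventually.of_forall fun δ => Eventually.of_forall fun u => ?_
      rw [Real.norm_eq_abs, abs_mul, Real.abs_exp]
      exact mul_le_mul_of_nonneg_left (hK _) (Real.exp_pos _).le
    · refine (MeasureTheory.ae_restrict_iff' measurableSet_Ioi).2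
          (Eventually.of_forall fun u hu => ?_)
      refine (hD.comp ?_).const_mul _
      have := (tendsto_inv_nhdsGT_zero (𝕜 := ℝ)).const_mul_atTop (show (0 : ℝ) < u from hu)
      exact this.congr fun x => (div_eq_mul_inv u x).symm
  rw [MeasureTheory.integral_mul_const, integral_exp_neg_Ioi_zero, one_mul] at hlim
  exact hlim.congr' (by filter_upwards [self_mem_nhdsWithin] with δ hδ using (hasInt δ hδ).symm)

theorem exp_neg_mul_log_natCast {n : ℕ} (hn : 0 < n) (δ : ℝ) :
    1 / (n : ℝ) * Real.exp (-(δ * Real.log n)) = (n : ℝ) ^ (-(1 + δ)) := by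
  have h0 : (0 : ℝ) < n := by exact_mod_cast hn
  rw [neg_add, Real.rpow_add h0, Real.rpow_neg_one, Real.rpow_def_of_pos h0, one_div]
  ring_nf

theorem hasSum_one_div_mul_exp_neg {δ : ℝ} (hδ : 0 < δ) :
    HasSum (fun n : ℕ => 1 / (n : ℝ) * Real.exp (-(δ * n))) (-Real.log (1 - Real.exp (-δ))) := by
  have h := Real.hasSum_pow_div_log_of_abs_lt_one (x := Real.exp (-δ)) (by
    rw [Real.abs_exp]; exact (by rw [← Real.exp_zero]; exact Real.exp_lt_exp.2 (by linarith)))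
  rw [← hasSum_nat_add_iff' 1]
  simp only [Finset.sum_range_one, Nat.cast_zero, div_zero, zero_mul, sub_zero]
  refine h.congr_fun fun n => ?_
  rw [← Real.exp_nat_mul]
  push_cast
  rw [one_div_mul_eq_div]
  ring_nf

/-- The second-order part of the logarithm of the Euler factor at `n`, supported on primes. -/
noncomputable def eulerRemainder (δ : ℝ) (n : ℕ) : ℝ :=
  if n.Prime then -Real.log (1 - (n : ℝ) ^ (-(1 + δ))) - (n : ℝ) ^ (-(1 + δ)) else 0

theorem rpow_neg_one_add_le_half {p : ℕ} (hp : p.Prime) {δ : ℝ} (hδ : 0 ≤ δ) :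
    (p : ℝ) ^ (-(1 + δ)) ≤ 1 / p ∧ (p : ℝ) ^ (-(1 + δ)) ≤ 1 / 2 := by
  have h2 : (2 : ℝ) ≤ p := by exact_mod_cast hp.two_le
  have h1 : (p : ℝ) ^ (-(1 + δ)) ≤ 1 / p := by
    rw [one_div, ← Real.rpow_neg_one]
    exact Real.rpow_le_rpow_of_exponent_le (by linarith) (by linarith)
  exact ⟨h1, h1.trans (one_div_le_one_div_of_le two_pos h2)⟩

theorem norm_eulerRemainder_le {δ : ℝ} (hδ : 0 ≤ δ) (n : ℕ) :
    ‖eulerRemainder δ n‖ ≤ 2 * (1 / (n : ℝ) ^ 2) := by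
  unfold eulerRemainder
  split_ifs with hn
  · obtain ⟨h1, h2⟩ := rpow_neg_one_add_le_half hn hδ
    have h0 : 0 ≤ (n : ℝ) ^ (-(1 + δ)) := by positivity
    set x := (n : ℝ) ^ (-(1 + δ))
    have h := Real.abs_log_sub_add_sum_range_le (x := x) (by rw [abs_of_nonneg h0]; linarith) 1
    simp only [Finset.sum_range_one, zero_add, pow_one, Nat.cast_zero, div_one] at h
    rw [Real.norm_eq_abs, ← abs_neg, neg_sub, sub_neg_eq_add]
    refine h.trans ?_
    rw [abs_of_nonneg h0, div_le_iff₀ (by linarith), ← one_div_pow]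
    nlinarith [pow_le_pow_left₀ h0 h1 2]
  · simp

theorem summable_eulerRemainder {δ : ℝ} (hδ : 0 ≤ δ) : Summable (eulerRemainder δ) :=
  Summable.of_norm_bounded ((Real.summable_one_div_nat_pow.2 one_lt_two).mul_left 2)
    (norm_eulerRemainder_le hδ)

theorem tendsto_tsum_eulerRemainder :
    Tendsto (fun δ => ∑' n, eulerRemainder δ n) (nhdsWithin 0 (Set.Ioi 0))
      (nhds (∑' n, eulerRemainder 0 n)) := by
  refine tendsto_tsum_of_dominated_convergence
    ((Real.summable_one_div_nat_pow.2 one_lt_two).mul_left 2) (fun n => ?_)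
    (by filter_upwards [self_mem_nhdsWithin] with δ hδ using norm_eulerRemainder_le (le_of_lt hδ))
  refine tendsto_nhdsWithin_of_tendsto_nhds ?_
  unfold eulerRemainder
  split_ifs with hn
  · have h0 : (n : ℝ) ≠ 0 := by exact_mod_cast hn.ne_zero
    have h1 : ContinuousAt (fun δ : ℝ => (n : ℝ) ^ (-(1 + δ))) 0 :=
      ContinuousAt.rpow (by fun_prop) (by fun_prop) (Or.inl h0)
    have h2 : (1 : ℝ) - (n : ℝ) ^ (-(1 + (0 : ℝ))) ≠ 0 := by
      refine ne_of_gt ?_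
      exact sub_pos.2 ((rpow_neg_one_add_le_half (δ := 0) hn le_rfl).2.trans_lt (by norm_num))
    exact (((continuousAt_const.sub h1).log h2).neg.sub h1).tendsto
  · exact tendsto_const_nhds

theorem summable_prime_mul_exp_neg {δ : ℝ} (hδ : 0 < δ) :
    Summable fun n : ℕ => (if n.Prime then 1 / (n : ℝ) else 0) *
      Real.exp (-(δ * Real.log n)) := by
  refine (Real.summable_nat_rpow.2 (by linarith : -(1 + δ) < -1)).of_nonneg_of_le
    (fun n => ?_) fun n => ?_
  · split_ifs <;> positivity
  · split_ifs with hn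
    · rw [exp_neg_mul_log_natCast hn.pos]
    · simp; positivity

theorem mul_riemannZeta_eq_exp {δ : ℝ} (hδ : 0 < δ) :
    riemannZeta (1 + δ : ℝ) = (Real.exp (∑' n : ℕ, ((if n.Prime then 1 / (n : ℝ) else 0) *
      Real.exp (-(δ * Real.log n)) + eulerRemainder δ n)) : ℝ) := by
  rw [← riemannZeta_eulerProduct_exp_log (by simpa using hδ), Complex.ofReal_exp,
      Complex.ofReal_tsum]
  congr 1
  have : ∀ n : ℕ, (((if n.Prime then 1 / (n : ℝ) else 0) *
      Real.exp (-(δ * Real.log n)) + eulerRemainder δ n : ℝ) : ℂ) =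
      Set.indicator {p : ℕ | p.Prime}
        (fun p : ℕ => -Complex.log (1 - (p : ℂ) ^ (-((1 + δ : ℝ) : ℂ)))) n := fun n => by
    by_cases hn : n.Prime
    · have h2 := (rpow_neg_one_add_le_half hn hδ.le).2
      simp only [eulerRemainder, hn, if_true, Set.indicator, Set.mem_ofPred_eq]
      rw [exp_neg_mul_log_natCast hn.pos, add_sub_cancel, ← Complex.ofReal_natCast,
        ← Complex.ofReal_neg, ← Complex.ofReal_cpow (by positivity), ← Complex.ofReal_one,
        ← Complex.ofReal_sub, ← Complex.ofReal_log (by linarith), ← Complex.ofReal_neg]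
    · simp [eulerRemainder, hn]
  simp_rw [this]
  exact tsum_subtype {p : ℕ | p.Prime}
    (fun p : ℕ => -Complex.log (1 - (p : ℂ) ^ (-((1 + δ : ℝ) : ℂ))))

theorem tendsto_tsum_prime_add_log :
    Tendsto (fun δ : ℝ => ∑' n : ℕ, (if n.Prime then 1 / (n : ℝ) else 0) *
      Real.exp (-(δ * Real.log n)) + Real.log δ) (nhdsWithin 0 (Set.Ioi 0))
      (nhds (-∑' n, eulerRemainder 0 n)) := by
  set S : ℝ → ℝ := fun δ => ∑' n : ℕ, ((if n.Prime then 1 / (n : ℝ) else 0) *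
      Real.exp (-(δ * Real.log n)) + eulerRemainder δ n)
  have h1 : Tendsto (fun δ : ℝ => ((δ * Real.exp (S δ) : ℝ) : ℂ)) (nhdsWithin 0 (Set.Ioi 0))
      (nhds 1) := by
    have h2 : Tendsto (fun δ : ℝ => ((1 + δ : ℝ) : ℂ)) (nhdsWithin 0 (Set.Ioi 0))
        (nhdsWithin 1 {1}ᶜ) := by
      refine tendsto_nhdsWithin_iff.2 ⟨tendsto_nhdsWithin_of_tendsto_nhds ?_, ?_⟩
      · have : Continuous fun δ : ℝ => ((1 + δ : ℝ) : ℂ) := by fun_prop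
        simpa using this.tendsto 0
      · filter_upwards [self_mem_nhdsWithin] with δ hδ
        have : δ ≠ 0 := ne_of_gt hδ
        simpa using this
    refine (riemannZeta_residue_one.comp h2).congr' ?_
    filter_upwards [self_mem_nhdsWithin] with δ hδ
    simp only [Function.comp_apply]
    rw [mul_riemannZeta_eq_exp hδ]
    rw [Complex.ofReal_mul, Complex.ofReal_add, Complex.ofReal_one, add_sub_cancel_left]
  have h3 : Tendsto (fun δ : ℝ => δ * Real.exp (S δ)) (nhdsWithin 0 (Set.Ioi 0)) (nhds 1) := by
    exact (Complex.continuous_re.tendsto _).comp h1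
  have h4 := (h3.log one_ne_zero).sub tendsto_tsum_eulerRemainder
  rw [Real.log_one, zero_sub] at h4
  refine h4.congr' ?_
  filter_upwards [self_mem_nhdsWithin] with δ hδ
  have hδ0 : (0 : ℝ) < δ := hδ
  rw [Real.log_mul hδ0.ne' (Real.exp_pos _).ne', Real.log_exp]
  simp only [S]
  rw [(summable_prime_mul_exp_neg hδ0).tsum_add (summable_eulerRemainder hδ0.le)]
  ring

theorem tendsto_sum_one_div_primesLE_sub_eulerMascheroni :
    Tendsto (fun x : ℝ => ∑ p ∈ ⌊x⌋₊.primesLE, (1 : ℝ) / p - Real.log (Real.log x)) atTop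
      (nhds (Real.eulerMascheroniConstant - ∑' n, eulerRemainder 0 n)) := by
  obtain ⟨M, C, hC0, hC⟩ := exists_abs_sum_one_div_primesLE_sub_log_log_le
  have hM : Tendsto (fun x : ℝ => ∑ p ∈ ⌊x⌋₊.primesLE, (1 : ℝ) / p - Real.log (Real.log x)) atTop
      (nhds M) := by
    rw [tendsto_iff_norm_sub_tendsto_zero]
    refine squeeze_zero' (Eventually.of_forall fun _ => norm_nonneg _) ?_
      ((tendsto_const_nhds (x := C)).div_atTop Real.tendsto_log_atTop)
    filter_upwards [eventually_ge_atTop 2] with x hx using hC x hx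
  have hfl : Tendsto (fun t : ℝ => Real.log t - Real.log (⌊t⌋₊ : ℝ)) atTop (nhds 0) := by
    have h := (tendsto_nat_floor_div_atTop (R := ℝ)).log one_ne_zero
    rw [Real.log_one] at h
    have h' := h.neg
    rw [neg_zero] at h'
    refine h'.congr' ?_
    filter_upwards [eventually_ge_atTop 1] with t ht
    have h1 : (⌊t⌋₊ : ℝ) ≠ 0 := by exact_mod_cast (Nat.floor_pos.2 ht).ne'
    rw [Real.log_div h1 (by linarith)]
    ring
  have hD : Tendsto (fun t : ℝ => ∑ n ∈ Finset.range (⌊Real.exp t⌋₊ + 1),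
      (if n.Prime then 1 / (n : ℝ) else 0) -
      ∑ n ∈ Finset.range (⌊t⌋₊ + 1), 1 / (n : ℝ)) atTop
      (nhds (M - Real.eulerMascheroniConstant)) := by
    have h1 := (hM.comp Real.tendsto_exp_atTop).sub
      (Real.tendsto_harmonic_sub_log.comp (tendsto_nat_floor_atTop (α := ℝ)))
    have h2 := h1.add hfl
    rw [add_zero] at h2
    refine h2.congr fun t => ?_
    simp only [Function.comp_apply, Real.log_exp]
    rw [← Finset.sum_filter, Nat.primesLE_eq_filter_Icc_zero, harmonic_eq_sum_Icc]
    have e1 : (Finset.range (⌊Real.exp t⌋₊ + 1)) = Finset.Icc 0 ⌊Real.exp t⌋₊ := by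
      ext; simp
    have e2 : ∑ n ∈ Finset.range (⌊t⌋₊ + 1), 1 / (n : ℝ) =
        ∑ n ∈ Finset.Icc 1 ⌊t⌋₊, 1 / (n : ℝ) := by
      refine (Finset.sum_subset (fun n hn => ?_) fun n hn hn' => ?_).symm
      · simp at hn ⊢; omega
      · have : n = 0 := by simp at hn hn'; omega
        simp [this]
    rw [e1, e2]
    push_cast
    simp only [one_div]
    ring
  have hK := tendsto_tsum_mul_exp_log_sub (a := fun n => if n.Prime then 1 / (n : ℝ) else 0)
    (b := fun n => 1 / (n : ℝ)) (fun n => by split_ifs <;> positivity)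
    (fun n => by positivity) (fun δ hδ => summable_prime_mul_exp_neg hδ)
    (fun δ hδ => (hasSum_one_div_mul_exp_neg hδ).summable) hD
  have hlog : Tendsto (fun δ : ℝ => Real.log (1 - Real.exp (-δ)) - Real.log δ)
      (nhdsWithin 0 (Set.Ioi 0)) (nhds 0) := by
    have h1 : HasDerivAt (fun δ : ℝ => 1 - Real.exp (-δ)) 1 0 := by
      have := ((hasDerivAt_neg (0 : ℝ)).exp).const_sub 1
      simpa using this
    have h2 := h1.tendsto_slope_zero_right.log one_ne_zero
    rw [Real.log_one] at h2
    refine h2.congr' ?_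
    filter_upwards [self_mem_nhdsWithin] with δ hδ
    have hδ0 : (0 : ℝ) < δ := hδ
    have h3 : Real.exp (-δ) < 1 := (by rw [← Real.exp_zero]; exact Real.exp_lt_exp.2 (by linarith))
    simp only [zero_add, neg_zero, Real.exp_zero, sub_self, sub_zero, smul_eq_mul]
    rw [Real.log_mul (inv_pos.2 hδ0).ne' (by linarith), Real.log_inv]
    ring
  have hfin := tendsto_tsum_prime_add_log.add hlog
  have huniq := tendsto_nhds_unique (hfin.congr' ?_) hK
  · have : Real.eulerMascheroniConstant - ∑' n, eulerRemainder 0 n = M := by linarith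
    rwa [this]
  · filter_upwards [self_mem_nhdsWithin] with δ hδ
    rw [(hasSum_one_div_mul_exp_neg hδ).tsum_eq]
    ring

/-- **Mertens' third theorem**, in logarithmic form. -/
theorem tendsto_sum_neg_log_one_sub_primesLE :
    Tendsto (fun x : ℝ => ∑ p ∈ ⌊x⌋₊.primesLE, -Real.log (1 - 1 / p) - Real.log (Real.log x)) atTop
      (nhds Real.eulerMascheroniConstant) := by
  have h1 := ((summable_eulerRemainder le_rfl).hasSum.tendsto_sum_nat.comp
    (tendsto_add_atTop_nat 1)).comp (tendsto_nat_floor_atTop (α := ℝ))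
  have h2 := tendsto_sum_one_div_primesLE_sub_eulerMascheroni.add h1
  rw [sub_add_cancel] at h2
  refine h2.congr fun x => ?_
  have e1 : (Finset.range (⌊x⌋₊ + 1)) = Finset.Icc 0 ⌊x⌋₊ := by
    ext; simp
  simp only [Function.comp_apply, eulerRemainder, e1]
  rw [← Finset.sum_filter, ← Nat.primesLE_eq_filter_Icc_zero, Finset.sum_sub_distrib]
  simp only [add_zero, Real.rpow_neg_one, one_div]
  ring

/-- **Mertens' third theorem**. -/
theorem tendsto_prod_one_sub_primesLE_mul_log :
    Tendsto (fun x : ℝ => (∏ p ∈ ⌊x⌋₊.primesLE, (1 - 1 / (p : ℝ))) * Real.log x) atTop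
      (nhds (Real.exp (-Real.eulerMascheroniConstant))) := by
  refine (tendsto_sum_neg_log_one_sub_primesLE.neg.rexp).congr' ?_
  filter_upwards [eventually_gt_atTop 1] with x hx
  rw [neg_sub, sub_eq_add_neg, Real.exp_add, Real.exp_log (Real.log_pos hx),
    Finset.sum_neg_distrib, neg_neg, Real.exp_sum, mul_comm]
  congr 1
  refine Finset.prod_congr rfl fun p hp => ?_
  have h2 : (2 : ℝ) ≤ p := by exact_mod_cast (Nat.prime_of_mem_primesLE hp).two_le
  rw [Real.exp_log]
  have := one_div_le_one_div_of_le two_pos h2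
  linarith

/-- The Mertens product over the primes up to `x`. -/
noncomputable def mertensProd (x : ℝ) : ℝ := ∏ p ∈ ⌊x⌋₊.primesLE, (1 - 1 / (p : ℝ))

theorem one_sub_one_div_prime_pos {p : ℕ} (hp : p.Prime) : 0 < 1 - 1 / (p : ℝ) := by
  have h2 : (2 : ℝ) ≤ p := by exact_mod_cast hp.two_le
  have := one_div_le_one_div_of_le two_pos h2
  linarith

theorem mertensProd_pos (x : ℝ) : 0 < mertensProd x :=
  Finset.prod_pos fun _ hp => one_sub_one_div_prime_pos (Nat.prime_of_mem_primesLE hp)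

theorem totient_eq_mul_prod_one_sub (m : ℕ) :
    (m.totient : ℝ) = m * ∏ p ∈ m.primeFactors, (1 - 1 / (p : ℝ)) := by
  have h := congrArg (fun q : ℚ => (q : ℝ)) (Nat.totient_eq_mul_prod_factors m)
  push_cast at h
  simpa only [one_div] using h

theorem le_usigma (n : ℕ) : n ≤ usigma n := by
  rcases n.eq_zero_or_pos with rfl | hn
  · exact Nat.zero_le _
  · conv_lhs => rw [← Nat.prod_factorization_pow_eq_self hn.ne']
    rw [usigma, Finsupp.prod, Finsupp.prod]
    exact Finset.prod_le_prod (fun _ _ => Nat.zero_le _) fun p _ => Nat.le_succ _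

theorem usigma_le_sq {n : ℕ} (hn : n ≠ 0) : usigma n ≤ n ^ 2 := by
  conv_rhs => rw [← Nat.prod_factorization_pow_eq_self hn]
  rw [usigma, Finsupp.prod, Finsupp.prod, ← Finset.prod_pow]
  refine Finset.prod_le_prod (fun _ _ => Nat.zero_le _) fun p hp => ?_
  rw [Nat.support_factorization] at hp
  have hp' := Nat.prime_of_mem_primeFactors hp
  have ha : n.factorization p ≠ 0 := by
    rwa [← Finsupp.mem_support_iff, Nat.support_factorization]
  have h2 : 2 ≤ p ^ n.factorization p := hp'.two_le.trans (Nat.le_self_pow ha p)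
  nlinarith

theorem card_filter_primeFactors_mul_log_le {m : ℕ} (hm : m ≠ 0) {Y : ℝ} (hY : 0 < Y) :
    ((m.primeFactors.filter fun p : ℕ => Y < p).card : ℝ) * Real.log Y ≤ Real.log m := by
  rw [← nsmul_eq_mul, ← Finset.sum_const]
  calc ∑ _p ∈ m.primeFactors.filter fun p : ℕ => Y < p, Real.log Y
      ≤ ∑ p ∈ m.primeFactors.filter fun p : ℕ => Y < p, Real.log p :=
        Finset.sum_le_sum fun p hp => Real.log_le_log hY (Finset.mem_filter.1 hp).2.le
    _ ≤ ∑ p ∈ m.primeFactors, Real.log p :=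
        Finset.sum_le_sum_of_subset_of_nonneg (Finset.filter_subset _ _)
          fun p _ _ => Real.log_natCast_nonneg p
    _ = Real.log (∏ p ∈ m.primeFactors, p : ℕ) := by
        rw [Nat.cast_prod, Real.log_prod]
        intro p hp
        exact_mod_cast (Nat.prime_of_mem_primeFactors hp).ne_zero
    _ ≤ Real.log m := by
        refine Real.log_le_log ?_ ?_
        · exact_mod_cast Finset.prod_pos fun p hp => (Nat.prime_of_mem_primeFactors hp).pos
        · exact_mod_cast Nat.le_of_dvd (Nat.pos_of_ne_zero hm) (Nat.prod_primeFactors_dvd m)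

theorem mul_mertensProd_log_le_totient {m : ℕ} (hm : 1 < Real.log m) :
    m * (mertensProd (Real.log m) * (1 - 1 / Real.log (Real.log m))) ≤ m.totient := by
  have hm0 : m ≠ 0 := by rintro rfl; norm_num at hm
  set Y := Real.log m with hY
  have hY0 : 0 < Y := by linarith
  have hlY : 0 < Real.log Y := Real.log_pos hm
  rw [totient_eq_mul_prod_one_sub]
  refine mul_le_mul_of_nonneg_left ?_ (Nat.cast_nonneg m)
  rw [← Finset.prod_filter_mul_prod_filter_not m.primeFactors (fun p : ℕ => Y < (p : ℝ)), mul_comm]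
  have h1 : 1 - 1 / Real.log Y ≤ ∏ p ∈ m.primeFactors with Y < (p : ℕ), (1 - 1 / (p : ℝ)) := by
    have hcard := card_filter_primeFactors_mul_log_le hm0 hY0
    set s := m.primeFactors.filter fun p : ℕ => Y < p
    calc 1 - 1 / Real.log Y ≤ 1 + s.card * (-(1 / Y)) := by
          have : (s.card : ℝ) * (1 / Y) ≤ 1 / Real.log Y := by
            rw [mul_one_div, div_le_div_iff₀ hY0 hlY, one_mul]
            exact hcard
          linarith
      _ ≤ (1 + -(1 / Y)) ^ s.card := by
          refine one_add_mul_le_pow ?_ _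
          have : 1 / Y ≤ 1 := (div_le_one hY0).2 hm.le
          linarith
      _ = ∏ p ∈ s, (1 + -(1 / Y)) := by rw [Finset.prod_const]
      _ ≤ _ := by
          refine Finset.prod_le_prod (fun p _ => ?_) fun p hp => ?_
          · have : 1 / Y ≤ 1 := (div_le_one hY0).2 hm.le
            linarith
          · have := one_div_le_one_div_of_le hY0 (Finset.mem_filter.1 hp).2.le
            linarith
  have h2 : mertensProd Y ≤ ∏ p ∈ m.primeFactors with ¬ Y < (p : ℕ), (1 - 1 / (p : ℝ)) := by
    refine Finset.prod_le_prod_of_subset_of_le_one (fun p hp => ?_) ?_ ?_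
    · rw [Finset.mem_filter, not_lt] at hp
      exact Nat.mem_primesLE.2 ⟨Nat.le_floor hp.2, Nat.prime_of_mem_primeFactors hp.1⟩
    · exact fun p hp => (one_sub_one_div_prime_pos (Nat.prime_of_mem_primesLE hp)).le
    · intro p _ _
      have : (0 : ℝ) ≤ 1 / p := by positivity
      linarith
  refine (mul_le_mul_of_nonneg_right h1 (mertensProd_pos _).le).trans ?_
  refine mul_le_mul_of_nonneg_left h2 (Finset.prod_nonneg fun p hp => ?_)
  exact (one_sub_one_div_prime_pos (Nat.prime_of_mem_primeFactors (Finset.mem_filter.1 hp).1)).le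

theorem tendsto_usigma_atTop : Tendsto usigma atTop atTop :=
  tendsto_atTop_mono le_usigma tendsto_id

theorem eventually_le_totient_usigma {c : ℝ} (hc : c < Real.exp (-Real.eulerMascheroniConstant)) :
    ∀ᶠ n : ℕ in atTop, c ≤ (Nat.totient (usigma n) : ℝ) * Real.log (Real.log n) / n := by
  have hlog2 : Tendsto (fun Y : ℝ => 1 - 1 / Real.log Y) atTop (nhds 1) := by
    simpa using (tendsto_const_nhds (x := (1 : ℝ))).sub
      ((tendsto_const_nhds (x := (1 : ℝ))).div_atTop Real.tendsto_log_atTop)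
  have hlog3 : Tendsto (fun Y : ℝ => 1 - Real.log 2 / Real.log Y) atTop (nhds 1) := by
    simpa using (tendsto_const_nhds (x := (1 : ℝ))).sub
      ((tendsto_const_nhds (x := Real.log 2)).div_atTop Real.tendsto_log_atTop)
  have hlim := (tendsto_prod_one_sub_primesLE_mul_log.mul hlog2).mul hlog3
  rw [mul_one, mul_one] at hlim
  have hY : Tendsto (fun n : ℕ => Real.log (usigma n)) atTop atTop :=
    Real.tendsto_log_atTop.comp (tendsto_natCast_atTop_atTop.comp tendsto_usigma_atTop)
  filter_upwards [(hlim.comp hY).eventually_const_lt hc, hY.eventually_gt_atTop (Real.exp 1),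
    (Real.tendsto_log_atTop.comp tendsto_natCast_atTop_atTop).eventually_gt_atTop 1]
    with n h1 h2' h3
  simp only [Function.comp_apply] at h1 h3
  have hn0 : n ≠ 0 := by rintro rfl; norm_num at h3
  have hnp : (0 : ℝ) < n := by exact_mod_cast Nat.pos_of_ne_zero hn0
  set Y := Real.log (usigma n) with hYdef
  have h2 : 1 < Y := (Real.one_lt_exp_iff.2 one_pos).trans h2'
  have hlY : 1 < Real.log Y := (Real.lt_log_iff_exp_lt (by linarith)).2 h2'
  have hll : 0 < Real.log (Real.log n) := Real.log_pos h3
  have h4 := mul_mertensProd_log_le_totient h2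
  have h5 : Real.log Y - Real.log 2 ≤ Real.log (Real.log n) := by
    rw [sub_le_iff_le_add, ← Real.log_mul (by linarith) two_ne_zero]
    refine Real.log_le_log (by linarith) ?_
    have : (usigma n : ℝ) ≤ (n : ℝ) ^ 2 := by exact_mod_cast usigma_le_sq hn0
    have h6 := Real.log_le_log (by exact_mod_cast (Nat.pos_of_ne_zero hn0).trans_le (le_usigma n))
        this
    rw [Real.log_pow] at h6
    push_cast at h6
    linarith
  refine h1.le.trans ?_
  rw [le_div_iff₀ hnp]
  change mertensProd Y * Real.log Y * (1 - 1 / Real.log Y) * (1 - Real.log 2 / Real.log Y) * n ≤ _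
  have h7 : mertensProd Y * Real.log Y * (1 - 1 / Real.log Y) * (1 - Real.log 2 / Real.log Y) * n =
      n * (mertensProd Y * (1 - 1 / Real.log Y)) * (Real.log Y - Real.log 2) := by
    field_simp
  rw [h7]
  have hsig : (n : ℝ) ≤ usigma n := by exact_mod_cast le_usigma n
  have hP := mertensProd_pos Y
  have h8 : 0 ≤ 1 - 1 / Real.log Y := by
    have : 1 / Real.log Y ≤ 1 := (div_le_one (by linarith)).2 hlY.le
    linarith
  have h9 : 0 ≤ mertensProd Y * (1 - 1 / Real.log Y) := mul_nonneg hP.le h8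
  calc _ ≤ n * (mertensProd Y * (1 - 1 / Real.log Y)) * Real.log (Real.log n) := by gcongr
    _ ≤ usigma n * (mertensProd Y * (1 - 1 / Real.log Y)) * Real.log (Real.log n) := by gcongr
    _ ≤ _ := by gcongr

namespace DirichletCharacter

variable {N : ℕ} {χ : DirichletCharacter ℂ N}

variable (χ) in
/-- The summatory function of a Dirichlet character. -/
noncomputable def summatory (t : ℝ) : ℂ := ∑ k ∈ Finset.Icc 1 ⌊t⌋₊, χ (k : ZMod N)

theorem measurable_summatory : Measurable (summatory χ) :=
  (measurable_from_nat (f := fun n => ∑ k ∈ Finset.Icc 1 n, χ (k : ZMod N))).comp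
    Nat.measurable_floor

theorem mellin_summatory (s : ℂ) :
    mellin (summatory χ) (-s) =
      ∫ t in Set.Ioi (1 : ℝ), summatory χ t * (t : ℂ) ^ (-(s + 1)) := by
  rw [mellin]
  rw [← MeasureTheory.setIntegral_eq_of_subset_of_ae_sdiff_eq_zero (s := Set.Ioi (1 : ℝ))
    measurableSet_Ioi.nullMeasurableSet (Set.Ioi_subset_Ioi zero_le_one)]
  · refine MeasureTheory.setIntegral_congr_fun measurableSet_Ioi fun t _ => ?_
    rw [smul_eq_mul, mul_comm, neg_add, ← sub_eq_add_neg]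
  · have h1 : ∀ᵐ t : ℝ, t ≠ 1 := by
      simp [MeasureTheory.ae_iff]
    filter_upwards [h1] with t ht h
    have ht1 : t < 1 := lt_of_le_of_ne (not_lt.1 h.2) ht
    rw [summatory, Nat.floor_eq_zero.2 ht1]
    simp

variable [NeZero N]

theorem norm_sum_range_le (hχ : χ ≠ 1) (n : ℕ) :
    ‖∑ k ∈ Finset.range n, χ (k : ZMod N)‖ ≤ min (n : ℝ) N := by
  have htriv : ∀ m : ℕ, ‖∑ k ∈ Finset.range m, χ (k : ZMod N)‖ ≤ m := fun m => by
    refine (norm_sum_le _ _).trans ((Finset.sum_le_sum fun k _ => χ.norm_le_one _).trans ?_)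
    simp
  refine le_min (htriv n) ?_
  have hper : Function.Periodic (fun n : ℕ => ∑ k ∈ Finset.range n, χ (k : ZMod N)) N := by
    intro n
    have h1 : ∑ k ∈ Finset.range N, χ (k : ZMod N) = 0 := by
      have h0 := MulChar.sum_eq_zero_of_ne_one hχ
      rw [← h0]
      refine Finset.sum_nbij' (fun k => (k : ZMod N)) ZMod.val (by simp) ?_ ?_ (by simp) (by simp)
      · exact fun a _ => Finset.mem_range.2 (ZMod.val_lt a)
      · exact fun a ha => ZMod.val_cast_of_lt (Finset.mem_range.1 ha)
    simp only
    rw [add_comm n N, Finset.sum_range_add, h1, zero_add]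
    simp
  have h2 := hper.map_mod_nat n
  rw [← h2]
  exact (htriv _).trans (by exact_mod_cast (Nat.mod_lt n (Nat.pos_of_neZero N)).le)

theorem norm_summatory_le (hχ : χ ≠ 1) (hN : N ≠ 1) (t : ℝ) :
    ‖summatory χ t‖ ≤ min (⌊t⌋₊ : ℝ) N := by
  refine le_min ?_ ?_
  · refine (norm_sum_le _ _).trans ((Finset.sum_le_sum fun k _ => χ.norm_le_one _).trans ?_)
    simp
  · refine le_trans (le_of_eq ?_) ((norm_sum_range_le hχ (⌊t⌋₊ + 1)).trans (min_le_right _ _))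
    rw [summatory]
    congr 1
    refine Finset.sum_subset (fun k hk => ?_) fun k hk hk' => ?_
    · simp at hk ⊢; omega
    · have : k = 0 := by simp at hk hk'; omega
      rw [this]
      have : Nontrivial (ZMod N) := ZMod.nontrivial_iff.2 hN
      exact_mod_cast χ.map_zero

theorem differentiableAt_mellin_summatory (hχ : χ ≠ 1) (hN : N ≠ 1) {s : ℂ} (hs : 0 < s.re) :
    DifferentiableAt ℂ (fun s => s * mellin (summatory χ) (-s)) s := by
  have h1 : DifferentiableAt ℂ (mellin (summatory χ)) (-s) := by
    refine mellin_differentiableAt_of_isBigO_rpow (a := 0) (b := (-s).re - 1) ?_ ?_ (by simpa) ?_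
      (by linarith)
    · refine (MeasureTheory.LocallyIntegrable.mono (MeasureTheory.locallyIntegrable_const (N : ℝ))
        measurable_summatory.aestronglyMeasurable (Eventually.of_forall fun t => ?_)).locallyIntegrableOn
            _
      exact ((norm_summatory_le hχ hN t).trans (min_le_right _ _)).trans (le_abs_self _)
    · refine Asymptotics.IsBigO.of_bound N (Eventually.of_forall fun t => ?_)
      simpa using (norm_summatory_le hχ hN t).trans (min_le_right _ _)
    · refine Asymptotics.IsBigO.of_bound 1 ?_
      filter_upwards [Ioo_mem_nhdsGT (zero_lt_one (α := ℝ))] with t ht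
      rw [summatory, Nat.floor_eq_zero.2 ht.2]
      simp
  exact differentiableAt_id.mul (h1.comp s differentiableAt_id.neg)

theorem LFunction_eq_mul_mellin (hχ : χ ≠ 1) (hN : N ≠ 1) {s : ℂ} (hs : 0 < s.re) :
    LFunction χ s = s * mellin (summatory χ) (-s) := by
  have hopen : IsOpen {s : ℂ | 0 < s.re} := isOpen_lt continuous_const Complex.continuous_re
  have hA : AnalyticOnNhd ℂ (LFunction χ) {s : ℂ | 0 < s.re} := fun z _ =>
    (differentiable_LFunction hχ).analyticAt z
  have hB : AnalyticOnNhd ℂ (fun s => s * mellin (summatory χ) (-s)) {s : ℂ | 0 < s.re} :=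
    DifferentiableOn.analyticOnNhd (fun z hz =>
      (differentiableAt_mellin_summatory hχ hN hz).differentiableWithinAt) hopen
  refine hA.eqOn_of_preconnected_of_eventuallyEq hB (convex_halfSpace_re_gt 0).isPreconnected
    (z₀ := 2) (by simp) ?_ hs
  have hopen1 : IsOpen {s : ℂ | 1 < s.re} := isOpen_lt continuous_const Complex.continuous_re
  filter_upwards [hopen1.mem_nhds (show (2 : ℂ) ∈ {s : ℂ | 1 < s.re} by simp)] with z hz
  have hz1 : 1 < z.re := hz
  rw [LFunction_eq_LSeries χ hz1, mellin_summatory,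
    LSeries_eq_mul_integral _ zero_le_one hz1 (LSeriesSummable_of_one_lt_re χ hz1)]
  · rfl
  · refine Asymptotics.IsBigO.of_bound 1 (Eventually.of_forall fun n => ?_)
    have := (norm_summatory_le hχ hN n).trans (min_le_left _ _)
    simpa [summatory] using this

/-- A bound for `L(s, χ)` near `s = 1`. -/
theorem norm_LFunction_le (hχ : χ ≠ 1) (hN : N ≠ 1) {η : ℝ} (hη : 0 < η) (hη2 : η ≤ 1 / 2) {s : ℂ}
    (hs : ‖s - 1‖ ≤ η) : ‖LFunction χ s‖ ≤ 2 / η * (N : ℝ) ^ (2 * η) := by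
  have hre : 1 - η ≤ s.re := by
    have := (Complex.abs_re_le_norm (s - 1)).trans hs
    rw [Complex.sub_re, Complex.one_re, abs_le] at this
    linarith
  have hnorm : ‖s‖ ≤ 2 := by
    calc ‖s‖ = ‖(s - 1) + 1‖ := by rw [sub_add_cancel]
      _ ≤ ‖s - 1‖ + ‖(1 : ℂ)‖ := norm_add_le _ _
      _ ≤ 2 := by rw [norm_one]; linarith
  have hN0 : (0 : ℝ) < N := by exact_mod_cast Nat.pos_of_neZero N
  rw [LFunction_eq_mul_mellin hχ hN (by linarith), mellin_summatory, norm_mul]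
  have hasInt : ‖∫ t in Set.Ioi (1 : ℝ), summatory χ t * (t : ℂ) ^ (-(s + 1))‖ ≤
      ∫ t in Set.Ioi (1 : ℝ), (N : ℝ) ^ (2 * η) * t ^ (-1 - η) := by
    refine MeasureTheory.norm_integral_le_of_norm_le
      ((integrableOn_Ioi_rpow_of_lt (by linarith) one_pos).const_mul _) ?_
    refine (MeasureTheory.ae_restrict_iff' measurableSet_Ioi).2
        (Eventually.of_forall fun t ht => ?_)
    have ht1 : (1 : ℝ) < t := ht
    have ht0 : (0 : ℝ) < t := by linarith
    rw [norm_mul, Complex.norm_cpow_eq_rpow_re_of_pos ht0]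
    have h1 : ‖summatory χ t‖ ≤ t ^ (1 - 2 * η) * (N : ℝ) ^ (2 * η) := by
      have h := norm_summatory_le hχ hN t
      have ha : ‖summatory χ t‖ ≤ t := (h.trans (min_le_left _ _)).trans (Nat.floor_le ht0.le)
      have hb : ‖summatory χ t‖ ≤ N := h.trans (min_le_right _ _)
      calc ‖summatory χ t‖ = ‖summatory χ t‖ ^ (1 - 2 * η) * ‖summatory χ t‖ ^ (2 * η) := by
            rw [← Real.rpow_add_of_nonneg (norm_nonneg _) (by linarith) (by linarith)]
            simp
        _ ≤ _ := by
            gcongr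
            linarith
    calc ‖summatory χ t‖ * t ^ (-(s + 1)).re
        ≤ (t ^ (1 - 2 * η) * (N : ℝ) ^ (2 * η)) * t ^ (-2 + η) := by
          refine mul_le_mul h1 ?_ (by positivity) (by positivity)
          refine Real.rpow_le_rpow_of_exponent_le ht1.le ?_
          simp only [Complex.neg_re, Complex.add_re, Complex.one_re]
          linarith
      _ = (N : ℝ) ^ (2 * η) * t ^ (-1 - η) := by
          rw [mul_right_comm, ← Real.rpow_add ht0, mul_comm]
          ring_nf
  rw [MeasureTheory.integral_const_mul, integral_Ioi_rpow_of_lt (by linarith) one_pos] at hasInt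
  calc _ ≤ 2 * ((N : ℝ) ^ (2 * η) * (-1 ^ (-1 - η + 1) / (-1 - η + 1))) := by gcongr
    _ = _ := by
      rw [Real.one_rpow]
      have : -1 - η + 1 = -η := by ring
      rw [this]
      field_simp

theorem norm_deriv_LFunction_le (hχ : χ ≠ 1) (hN : N ≠ 1) {η : ℝ} (hη : 0 < η) (hη2 : η ≤ 1 / 2)
    {s : ℂ} (hs : ‖s - 1‖ ≤ η / 2) :
    ‖deriv (LFunction χ) s‖ ≤ 4 / η ^ 2 * (N : ℝ) ^ (2 * η) := by
  have h := Complex.norm_deriv_le_of_forall_mem_sphere_norm_le (f := LFunction χ) (c := s)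
    (R := η / 2) (C := 2 / η * (N : ℝ) ^ (2 * η)) (by linarith)
    (differentiable_LFunction hχ).diffContOnCl fun z hz => by
      refine norm_LFunction_le hχ hN hη hη2 ?_
      rw [mem_sphere_iff_norm] at hz
      calc ‖z - 1‖ = ‖(z - s) + (s - 1)‖ := by ring_nf
        _ ≤ ‖z - s‖ + ‖s - 1‖ := norm_add_le _ _
        _ ≤ η := by linarith
  refine h.trans (le_of_eq ?_)
  field_simp
  ring

end DirichletCharacter

/-- The weight `Λ(n) (log n) ^ k / n ^ (1 + δ)`. -/
noncomputable def logWeight (k : ℕ) (δ : ℝ) (n : ℕ) : ℝ :=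
  ArithmeticFunction.vonMangoldt n * Real.log n ^ k * (n : ℝ) ^ (-(1 + δ))

theorem logWeight_nonneg (k : ℕ) (δ : ℝ) (n : ℕ) : 0 ≤ logWeight k δ n := by
  have h1 := ArithmeticFunction.vonMangoldt_nonneg (n := n)
  have h2 := Real.log_natCast_nonneg n
  unfold logWeight
  positivity

theorem logMul_iterate_apply (f : ℕ → ℂ) (k n : ℕ) :
    LSeries.logMul^[k] f n = Complex.log n ^ k * f n := by
  induction k with
  | zero => simp
  | succ k ih => rw [Function.iterate_succ_apply', LSeries.logMul, ih]; ring

theorem term_logMul_iterate_mul_vonMangoldt (χ : ℕ → ℂ) (k : ℕ) (δ : ℝ) (n : ℕ) :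
    LSeries.term (LSeries.logMul^[k] (χ * fun n => (ArithmeticFunction.vonMangoldt n : ℂ)))
      ((1 + δ : ℝ) : ℂ) n = χ n * (logWeight k δ n : ℝ) := by
  rcases n.eq_zero_or_pos with rfl | hn
  · simp [logWeight]
  · rw [LSeries.term_of_ne_zero hn.ne', logMul_iterate_apply, logWeight, ← Complex.natCast_log,
      Complex.ofReal_mul, Complex.ofReal_cpow (Nat.cast_nonneg n), Complex.ofReal_neg,
      Complex.cpow_neg, div_eq_mul_inv]
    push_cast [Pi.mul_apply]
    ring

theorem summable_logWeight (k : ℕ) {δ : ℝ} (hδ : 0 < δ) : Summable (logWeight k δ) := by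
  have h1 : LSeries.abscissaOfAbsConv (LSeries.logMul^[k]
      ((1 : ℕ → ℂ) * fun n => (ArithmeticFunction.vonMangoldt n : ℂ))) <
        (((1 + δ : ℝ) : ℂ).re : ℝ) := by
    rw [LSeries.absicssaOfAbsConv_logPowMul, one_mul]
    refine lt_of_le_of_lt (LSeries.abscissaOfAbsConv_le_of_forall_lt_LSeriesSummable (x := 1)
      fun y hy => ArithmeticFunction.LSeriesSummable_vonMangoldt (by simpa using hy)) ?_
    rw [Complex.ofReal_re]
    exact_mod_cast (by linarith : (1 : ℝ) < 1 + δ)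
  have h2 := LSeriesSummable_of_abscissaOfAbsConv_lt_re h1
  rw [LSeriesSummable, funext (term_logMul_iterate_mul_vonMangoldt _ k δ)] at h2
  refine (Complex.summable_ofReal.1 (h2.congr fun n => ?_))
  simp

theorem tendsto_mul_norm_riemannZeta :
    Tendsto (fun δ : ℝ => δ * ‖riemannZeta (1 + δ : ℝ)‖) (nhdsWithin 0 (Set.Ioi 0)) (nhds 1) := by
  have h2 : Tendsto (fun δ : ℝ => ((1 + δ : ℝ) : ℂ)) (nhdsWithin 0 (Set.Ioi 0))
      (nhdsWithin 1 {1}ᶜ) := by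
    refine tendsto_nhdsWithin_iff.2 ⟨tendsto_nhdsWithin_of_tendsto_nhds ?_, ?_⟩
    · have : Continuous fun δ : ℝ => ((1 + δ : ℝ) : ℂ) := by fun_prop
      simpa using this.tendsto 0
    · filter_upwards [self_mem_nhdsWithin] with δ hδ
      have : δ ≠ 0 := ne_of_gt hδ
      simpa using this
  have h3 := (riemannZeta_residue_one.comp h2).norm
  rw [norm_one] at h3
  refine h3.congr' ?_
  filter_upwards [self_mem_nhdsWithin] with δ hδ
  have hδ0 : (0 : ℝ) < δ := hδ
  simp [abs_of_pos hδ0]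

theorem eventually_norm_riemannZeta_bounds :
    ∀ᶠ δ : ℝ in nhdsWithin 0 (Set.Ioi 0),
      1 / (2 * δ) ≤ ‖riemannZeta (1 + δ : ℝ)‖ ∧ ‖riemannZeta (1 + δ : ℝ)‖ ≤ 2 / δ := by
  filter_upwards [tendsto_mul_norm_riemannZeta.eventually_const_lt (by norm_num : (1 / 2 : ℝ) < 1),
    tendsto_mul_norm_riemannZeta.eventually_lt_const (by norm_num : (1 : ℝ) < 2),
    self_mem_nhdsWithin] with δ h1 h2 hδ
  have hδ0 : (0 : ℝ) < δ := hδ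
  constructor
  · rw [div_le_iff₀ (by positivity)]; linarith
  · rw [le_div_iff₀ hδ0]; linarith

theorem tsum_rpow_eq_norm_riemannZeta {δ : ℝ} (hδ : 0 < δ) :
    ∑' n : ℕ, (n : ℝ) ^ (-(1 + δ)) = ‖riemannZeta (1 + δ : ℝ)‖ := by
  rw [zeta_eq_tsum_one_div_nat_cpow (by simpa using hδ)]
  have : ∀ n : ℕ, 1 / (n : ℂ) ^ ((1 + δ : ℝ) : ℂ) = (((n : ℝ) ^ (-(1 + δ)) : ℝ) : ℂ) := fun n => by
    rw [one_div, Complex.ofReal_cpow (Nat.cast_nonneg n), Complex.ofReal_neg, Complex.cpow_neg]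
    simp
  simp_rw [this]
  rw [← Complex.ofReal_tsum, Complex.norm_real, Real.norm_of_nonneg]
  exact tsum_nonneg fun n => by positivity

namespace DirichletCharacter

variable {N : ℕ} [NeZero N] {χ : DirichletCharacter ℂ N}

theorem hasSum_mul_logWeight (χ : DirichletCharacter ℂ N) (k : ℕ) {δ : ℝ} (hδ : 0 < δ) :
    ∑' n : ℕ, χ (n : ZMod N) * (logWeight k δ n : ℂ) = (-1) ^ k *
      iteratedDeriv k (fun s => -(deriv (LFunction χ) s / LFunction χ s)) ((1 + δ : ℝ) : ℂ) := by
  have hre : 1 < (((1 + δ : ℝ) : ℂ)).re := by rw [Complex.ofReal_re]; linarith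
  set f : ℕ → ℂ := (fun n : ℕ => χ (n : ZMod N)) *
    fun n => (ArithmeticFunction.vonMangoldt n : ℂ) with hf
  have habs : LSeries.abscissaOfAbsConv f < (((1 + δ : ℝ) : ℂ).re : ℝ) := by
    refine lt_of_le_of_lt (LSeries.abscissaOfAbsConv_le_of_forall_lt_LSeriesSummable (x := 1)
      fun y hy => LSeriesSummable_twist_vonMangoldt χ (by simpa using hy)) ?_
    exact_mod_cast hre
  have h1 := LSeries_iteratedDeriv k habs
  have hopen1 : IsOpen {s : ℂ | 1 < s.re} := isOpen_lt continuous_const Complex.continuous_re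
  have h2 : (fun s => -(deriv (LFunction χ) s / LFunction χ s)) =ᶠ[nhds (((1 + δ : ℝ) : ℂ))]
      LSeries f := by
    filter_upwards [hopen1.mem_nhds hre] with z hz
    rw [hf, LSeries_twist_vonMangoldt_eq χ hz, deriv_LFunction_eq_deriv_LSeries χ hz,
      LFunction_eq_LSeries χ hz, neg_div]
  rw [h2.iteratedDeriv_eq, h1, ← mul_assoc, ← mul_pow, neg_one_mul, neg_neg, one_pow, one_mul,
    LSeries]
  exact tsum_congr fun n => (term_logMul_iterate_mul_vonMangoldt
    (fun n : ℕ => χ (n : ZMod N)) k δ n).symm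

theorem norm_LFunctionTrivChar_le {R : ℝ} (hR : 0 < R) :
    ‖LFunctionTrivChar N ((1 + R : ℝ) : ℂ)‖ ≤ ‖riemannZeta (1 + R : ℝ)‖ := by
  have hre : 1 < (((1 + R : ℝ) : ℂ)).re := by rw [Complex.ofReal_re]; linarith
  have hne : ((1 + R : ℝ) : ℂ) ≠ 1 := by
    intro h
    rw [h] at hre
    simp at hre
  rw [LFunctionTrivChar_eq_mul_riemannZeta hne, norm_mul, norm_prod]
  refine mul_le_of_le_one_left (norm_nonneg _) (Finset.prod_le_one (fun _ _ => norm_nonneg _) ?_)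
  intro p hp
  have hp' := Nat.prime_of_mem_primeFactors hp
  have h := (rpow_neg_one_add_le_half hp' hR.le).2
  have h0 : 0 ≤ (p : ℝ) ^ (-(1 + R)) := by positivity
  rw [← Complex.ofReal_natCast, ← Complex.ofReal_neg, ← Complex.ofReal_cpow (by positivity),
    ← Complex.ofReal_one, ← Complex.ofReal_sub, Complex.norm_real,
    Real.norm_of_nonneg (by linarith)]
  linarith

theorem pow_three_le_norm_LFunction_pow_four (hχ2 : χ ^ 2 ≠ 1) (hN : N ≠ 1) {R η : ℝ} (hR : 0 < R)
    (hη : 0 < η) (hη2 : η ≤ 1 / 2) (hRη : R ≤ η)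
    (hζ : ‖riemannZeta (1 + R : ℝ)‖ ≤ 2 / R) :
    R ^ 3 ≤ 8 * (2 / η * (N : ℝ) ^ (2 * η)) * ‖LFunction χ ((1 + R : ℝ) : ℂ)‖ ^ 4 := by
  have h := norm_LFunction_product_ge_one χ hR 0
  have e : (1 : ℂ) + R = ((1 + R : ℝ) : ℂ) := by push_cast; ring
  simp only [Complex.ofReal_zero, mul_zero, add_zero, e, norm_mul, norm_pow] at h
  have h1 : ‖LFunctionTrivChar N ((1 + R : ℝ) : ℂ)‖ ≤ 2 / R :=
      (norm_LFunctionTrivChar_le hR).trans hζ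
  have h2 : ‖LFunction (χ ^ 2) ((1 + R : ℝ) : ℂ)‖ ≤ 2 / η * (N : ℝ) ^ (2 * η) := by
    refine norm_LFunction_le hχ2 hN hη hη2 ?_
    rw [← e, add_sub_cancel_left, Complex.norm_real, Real.norm_of_nonneg hR.le]
    exact hRη
  have h3 : 1 ≤ (2 / R) ^ 3 * ‖LFunction χ ((1 + R : ℝ) : ℂ)‖ ^ 4 *
      (2 / η * (N : ℝ) ^ (2 * η)) := by
    refine h.le.trans ?_
    gcongr
  rw [div_pow] at h3
  have hR3 : 0 < R ^ 3 := by positivity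
  calc R ^ 3 = R ^ 3 * 1 := (mul_one _).symm
    _ ≤ R ^ 3 * (2 ^ 3 / R ^ 3 * ‖LFunction χ ((1 + R : ℝ) : ℂ)‖ ^ 4 *
            (2 / η * (N : ℝ) ^ (2 * η))) := by
      gcongr
    _ = _ := by field_simp; ring

theorem norm_deriv_div_LFunction_le (hχ : χ ≠ 1) (hχ2 : χ ^ 2 ≠ 1) (hN : N ≠ 1) {R η : ℝ}
    (hR : 0 < R) (hη : 0 < η) (hη2 : η ≤ 1 / 2) (hRη : 4 * R ≤ η)
    (hζ : ‖riemannZeta (1 + R : ℝ)‖ ≤ 2 / R)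
    (hRN : 10368 * R * (4 / η ^ 2 * (N : ℝ) ^ (2 * η)) ^ 5 ≤ 1) {s : ℂ} (hs : ‖s - 1‖ ≤ 2 * R) :
    LFunction χ s ≠ 0 ∧ ‖deriv (LFunction χ) s / LFunction χ s‖ ≤ 1 / R := by
  set A := 4 / η ^ 2 * (N : ℝ) ^ (2 * η) with hA
  set l := ‖LFunction χ ((1 + R : ℝ) : ℂ)‖ with hl
  have hN0 : (0 : ℝ) < N := by exact_mod_cast Nat.pos_of_neZero N
  have hA0 : 0 < A := by positivity
  have h1 := pow_three_le_norm_LFunction_pow_four hχ2 hN hR hη hη2 (by linarith) hζ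
  have hA2 : 2 / η * (N : ℝ) ^ (2 * η) ≤ A := by
    refine mul_le_mul_of_nonneg_right ?_ (by positivity)
    rw [div_le_div_iff₀ hη (by positivity)]
    nlinarith
  have h2 : R ^ 3 ≤ 8 * A * l ^ 4 := by
    refine h1.trans ?_
    gcongr
  have h3 : 6 * R * A ≤ l := by
    refine le_of_pow_le_pow_left₀ four_ne_zero (norm_nonneg _) ?_
    have h4 : 8 * A * (6 * R * A) ^ 4 ≤ 8 * A * l ^ 4 := by
      refine le_trans ?_ h2
      calc 8 * A * (6 * R * A) ^ 4 = R ^ 3 * (10368 * R * A ^ 5) := by ring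
        _ ≤ R ^ 3 * 1 := by gcongr
        _ = R ^ 3 := mul_one _
    exact le_of_mul_le_mul_left h4 (by positivity)
  have hball : ∀ z ∈ Metric.closedBall (1 : ℂ) (2 * R), ‖deriv (LFunction χ) z‖ ≤ A := by
    intro z hz
    rw [mem_closedBall_iff_norm] at hz
    exact norm_deriv_LFunction_le hχ hN hη hη2 (by linarith)
  have hR1 : ((1 + R : ℝ) : ℂ) ∈ Metric.closedBall (1 : ℂ) (2 * R) := by
    rw [mem_closedBall_iff_norm]
    push_cast
    rw [add_sub_cancel_left, Complex.norm_real, Real.norm_of_nonneg hR.le]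
    linarith
  have hsb : s ∈ Metric.closedBall (1 : ℂ) (2 * R) := mem_closedBall_iff_norm.2 hs
  have hvar := Convex.norm_image_sub_le_of_norm_deriv_le (f := LFunction χ)
    (fun z _ => (differentiable_LFunction hχ).differentiableAt) hball (convex_closedBall _ _)
        hR1 hsb
  have hdist : ‖s - ((1 + R : ℝ) : ℂ)‖ ≤ 3 * R := by
    calc ‖s - ((1 + R : ℝ) : ℂ)‖ = ‖(s - 1) - (R : ℂ)‖ := by push_cast; ring_nf
      _ ≤ ‖s - 1‖ + ‖(R : ℂ)‖ := norm_sub_le _ _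
      _ ≤ 3 * R := by
        rw [Complex.norm_real, Real.norm_of_nonneg hR.le]
        linarith
  have hLs : R * A ≤ ‖LFunction χ s‖ := by
    have h5 : l - ‖LFunction χ s‖ ≤ ‖LFunction χ s - LFunction χ ((1 + R : ℝ) : ℂ)‖ := by
      rw [norm_sub_rev]
      exact norm_sub_norm_le _ _
    have h6 : A * ‖s - ((1 + R : ℝ) : ℂ)‖ ≤ A * (3 * R) := by gcongr
    have h7 : 0 < R * A := by positivity
    linarith
  have hpos : 0 < ‖LFunction χ s‖ := lt_of_lt_of_le (by positivity) hLs
  refine ⟨norm_pos_iff.1 hpos, ?_⟩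
  rw [norm_div, div_le_div_iff₀ hpos hR, one_mul, mul_comm]
  exact (mul_le_mul_of_nonneg_left (hball s hsb) hR.le).trans hLs

theorem norm_tsum_mul_logWeight_le (hχ : χ ≠ 1) (hχ2 : χ ^ 2 ≠ 1) (hN : N ≠ 1) {R η : ℝ}
    (hR : 0 < R) (hη : 0 < η) (hη2 : η ≤ 1 / 2) (hRη : 4 * R ≤ η)
    (hζ : ‖riemannZeta (1 + R : ℝ)‖ ≤ 2 / R)
    (hRN : 10368 * R * (4 / η ^ 2 * (N : ℝ) ^ (2 * η)) ^ 5 ≤ 1) {δ : ℝ} (hδ : 0 < δ) (hδR : δ ≤ R)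
    (k : ℕ) :
    ‖∑' n : ℕ, χ (n : ZMod N) * (logWeight k δ n : ℂ)‖ ≤ k.factorial / R ^ (k + 1) := by
  rw [hasSum_mul_logWeight χ k hδ, norm_mul, norm_pow, norm_neg, norm_one, one_pow, one_mul]
  have hdist : ∀ z : ℂ, ‖z - ((1 + δ : ℝ) : ℂ)‖ ≤ R → ‖z - 1‖ ≤ 2 * R := fun z hz => by
    calc ‖z - 1‖ = ‖(z - ((1 + δ : ℝ) : ℂ)) + (δ : ℂ)‖ := by push_cast; ring_nf
      _ ≤ ‖z - ((1 + δ : ℝ) : ℂ)‖ + ‖(δ : ℂ)‖ := norm_add_le _ _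
      _ ≤ 2 * R := by
        rw [Complex.norm_real, Real.norm_of_nonneg hδ.le]
        linarith
  have hmain := fun {z : ℂ} (hz : ‖z - 1‖ ≤ 2 * R) =>
    norm_deriv_div_LFunction_le hχ hχ2 hN hR hη hη2 hRη hζ hRN hz
  have h := Complex.norm_iteratedDeriv_le_of_forall_mem_sphere_norm_le
    (f := fun s => -(deriv (LFunction χ) s / LFunction χ s)) (c := ((1 + δ : ℝ) : ℂ)) (R := R)
    (C := 1 / R) k hR ?_ fun z hz => ?_
  · refine h.trans (le_of_eq ?_)
    field_simp
    ring
  · refine DifferentiableOn.diffContOnCl fun z hz => ?_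
    have hz' : ‖z - ((1 + δ : ℝ) : ℂ)‖ ≤ R := by
      rw [closure_ball _ hR.ne', mem_closedBall_iff_norm] at hz
      exact hz
    have hd := differentiable_LFunction hχ
    exact ((hd.contDiff.differentiable_deriv_two.differentiableAt).div hd.differentiableAt
      (hmain (hdist z hz')).1).neg.differentiableWithinAt
  · rw [mem_sphere_iff_norm] at hz
    rw [norm_neg]
    exact (hmain (hdist z hz.le)).2

end DirichletCharacter

namespace DirichletCharacter

variable {p : ℕ} [Fact p.Prime] {χ : DirichletCharacter ℂ p}

theorem isUnit_natCast_iff_ne {q : ℕ} (hq : q.Prime) : IsUnit (q : ZMod p) ↔ q ≠ p := by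
  rw [ZMod.isUnit_iff_coprime, Nat.coprime_primes hq Fact.out]

open Classical in
theorem summable_ite_eq_neg_one (χ : DirichletCharacter ℂ p) {δ : ℝ} (hδ : 0 < δ) :
    Summable fun q : Nat.Primes =>
      if χ ((q : ℕ) : ZMod p) = -1 then ((q : ℕ) : ℝ) ^ (-(1 + δ)) else 0 := by
  refine (Nat.Primes.summable_rpow.2 (by linarith : -(1 + δ) < -1)).of_nonneg_of_le
    (fun q => ?_) fun q => ?_
  · split_ifs <;> positivity
  · split_ifs
    · exact le_rfl
    · positivity

open Classical in
theorem neg_log_one_sub_le_of_sq_eq_one (hχ : χ ^ 2 = 1) {q : ℕ} (hq : q.Prime) {x : ℝ}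
    (hx : 0 ≤ x) (hx2 : x ≤ 1 / 2) :
    (-Complex.log (1 - (x : ℂ))).re ≤ (-Complex.log (1 - χ (q : ZMod p) * (x : ℂ))).re +
      (3 * (if χ (q : ZMod p) = -1 then x else 0) + if q = p then Real.log 2 else 0) := by
  have hre : ∀ y : ℝ, (-Complex.log (1 - (y : ℂ))).re = -Real.log (1 - y) := fun y => by
    rw [← Complex.ofReal_one, ← Complex.ofReal_sub, Complex.neg_re, Complex.log_ofReal_re]
  have hlog2 : 0 ≤ Real.log 2 := Real.log_nonneg one_le_two
  have hite : 0 ≤ if q = p then Real.log 2 else 0 := by split_ifs <;> simp [hlog2]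
  rcases MulChar.isQuadratic_iff_sq_eq_one.2 hχ (q : ZMod p) with h | h | h
  · have hqp : q = p := by
      by_contra hne
      exact (((isUnit_natCast_iff_ne hq).2 hne).map χ).ne_zero h
    have h1 : Real.log (1 / 2) ≤ Real.log (1 - x) :=
      Real.log_le_log (by norm_num) (by linarith)
    rw [one_div, Real.log_inv] at h1
    rw [hre, h, if_pos hqp, if_neg (by norm_num)]
    simp only [zero_mul, sub_zero, Complex.log_one, neg_zero, Complex.zero_re]
    linarith
  · rw [h, one_mul, if_neg (by norm_num)]
    linarith
  · have h1 : -(2 * x) ≤ Real.log (1 - x) := by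
      have h2 := Real.one_sub_inv_le_log_of_pos (by linarith : 0 < 1 - x)
      have h3 : (1 - x)⁻¹ ≤ 1 + 2 * x := by
        rw [inv_le_iff_one_le_mul₀ (by linarith)]
        nlinarith
      linarith
    have h2 : Real.log (1 + x) ≤ x := by
      have := Real.log_le_sub_one_of_pos (by linarith : 0 < 1 + x)
      linarith
    have h3 : (1 - (-1) * (x : ℂ)) = 1 - ((-x : ℝ) : ℂ) := by push_cast; ring
    rw [h, h3, hre, hre, if_pos rfl, sub_neg_eq_add]
    linarith

open Classical in
/-- Comparison of `ζ` with the `L`-function of a quadratic character near `s = 1`. -/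
theorem norm_riemannZeta_le_mul_exp (hχ : χ ^ 2 = 1) {δ : ℝ} (hδ : 0 < δ) :
    ‖riemannZeta (1 + δ : ℝ)‖ ≤ ‖LFunction χ (1 + δ : ℝ)‖ * (2 * Real.exp (3 *
      ∑' q : Nat.Primes,
        if χ ((q : ℕ) : ZMod p) = -1 then ((q : ℕ) : ℝ) ^ (-(1 + δ)) else 0)) := by
  have hs : 1 < (((1 + δ : ℝ) : ℂ)).re := by rw [Complex.ofReal_re]; linarith
  have hcast : ∀ q : ℕ, (q : ℂ) ^ (-((1 + δ : ℝ) : ℂ)) = (((q : ℝ) ^ (-(1 + δ)) : ℝ) : ℂ) :=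
    fun q => by
      rw [Complex.ofReal_cpow (Nat.cast_nonneg q)]
      push_cast
      rfl
  have hone : ∀ q : Nat.Primes, (1 : DirichletCharacter ℂ 1) ((q : ℕ) : ZMod 1) = 1 := fun q => by
    rw [Subsingleton.elim ((q : ℕ) : ZMod 1) 1, map_one]
  have hsum1 := summable_neg_log_one_sub_mul_prime_cpow (1 : DirichletCharacter ℂ 1) hs
  simp only [hone, one_mul] at hsum1
  have hsumχ := summable_neg_log_one_sub_mul_prime_cpow χ hs
  have hS := (summable_ite_eq_neg_one χ hδ).hasSum.mul_left 3
  have hp : HasSum (fun q : Nat.Primes => if q = ⟨p, Fact.out⟩ then Real.log 2 else 0)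
      (Real.log 2) := hasSum_ite_eq _ _
  have h2 : (2 : ℝ) = Real.exp (Real.log 2) := (Real.exp_log two_pos).symm
  rw [← riemannZeta_eulerProduct_exp_log hs, LFunction_eq_LSeries χ hs,
    ← LSeries_eulerProduct_exp_log χ hs, Complex.norm_exp, Complex.norm_exp, h2, ← Real.exp_add,
    ← Real.exp_add, Real.exp_le_exp, add_comm (Real.log 2)]
  refine hasSum_le (fun q => ?_) (Complex.hasSum_re hsum1.hasSum)
    ((Complex.hasSum_re hsumχ.hasSum).add (hS.add hp))
  have hb := rpow_neg_one_add_le_half q.2 hδ.le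
  have h := neg_log_one_sub_le_of_sq_eq_one hχ q.2 (x := ((q : ℕ) : ℝ) ^ (-(1 + δ)))
    (by positivity) hb.2
  have hqp : (q = (⟨p, Fact.out⟩ : Nat.Primes)) ↔ (q : ℕ) = p := Subtype.ext_iff
  simp only [hcast, hqp]
  exact h

end DirichletCharacter

theorem exists_sum_one_div_primesLE_exp_le :
    ∃ C : ℝ, 0 ≤ C ∧ ∀ V : ℝ, 1 ≤ V →
      ∑ q ∈ ⌊Real.exp V⌋₊.primesLE, (1 : ℝ) / q ≤ Real.log V + C := by
  obtain ⟨M, C, hC, h⟩ := exists_abs_sum_one_div_primesLE_sub_log_log_le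
  refine ⟨|M| + C, by positivity, fun V hV => ?_⟩
  have h2 : 2 ≤ Real.exp V := by linarith [Real.add_one_le_exp V]
  have := (abs_le.1 (h _ h2)).2
  rw [Real.log_exp] at this
  have h3 : C / V ≤ C := div_le_self hC hV
  linarith [le_abs_self M]

namespace DirichletCharacter

variable {p : ℕ} [Fact p.Prime] {χ : DirichletCharacter ℂ p}

theorem summable_ite_logWeight (P : ℕ → Prop) [DecidablePred P] (k : ℕ) {δ : ℝ} (hδ : 0 < δ) :
    Summable fun n : ℕ => if P n then logWeight k δ n else 0 := by
  refine (summable_logWeight k hδ).of_nonneg_of_le (fun n => ?_) fun n => ?_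
  · split_ifs
    exacts [logWeight_nonneg k δ n, le_rfl]
  · split_ifs
    exacts [le_rfl, logWeight_nonneg k δ n]

open Classical in
theorem mul_tsum_sub_sum_le (χ : DirichletCharacter ℂ p) (k : ℕ) {δ V : ℝ} (hδ : 0 < δ)
    (hV : 0 ≤ V) :
    V ^ (k + 1) * ((∑' q : Nat.Primes,
        if χ ((q : ℕ) : ZMod p) = -1 then ((q : ℕ) : ℝ) ^ (-(1 + δ)) else 0) -
      ∑ q ∈ ⌊Real.exp V⌋₊.primesLE, (1 : ℝ) / q) ≤
      ∑' n : ℕ, if χ (n : ZMod p) = -1 then logWeight k δ n else 0 := by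
  have hsum1 := (summable_ite_eq_neg_one χ hδ).hasSum
  have hw := summable_ite_logWeight (fun n : ℕ => χ (n : ZMod p) = -1) k hδ
  set f : ℕ → ℝ := fun q => if q.Prime ∧ χ (q : ZMod p) = -1 then (q : ℝ) ^ (-(1 + δ)) else 0
    with hf
  have hsum2 : HasSum f (∑' q : Nat.Primes,
      if χ ((q : ℕ) : ZMod p) = -1 then ((q : ℕ) : ℝ) ^ (-(1 + δ)) else 0) := by
    refine (Function.Injective.hasSum_iff (Subtype.val_injective (p := Nat.Prime)) ?_).1 ?_
    · intro n hn
      rw [hf]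
      refine if_neg fun h => hn ⟨⟨n, h.1⟩, rfl⟩
    · have hcomp : f ∘ Subtype.val = fun q : {q : ℕ // q.Prime} =>
          if χ ((q : ℕ) : ZMod p) = -1 then ((q : ℕ) : ℝ) ^ (-(1 + δ)) else 0 := by
        funext q
        simp [hf, q.2]
      rw [hcomp]
      exact hsum1
  have hsum3 : HasSum (fun q : ℕ => if q ∈ ⌊Real.exp V⌋₊.primesLE then (1 : ℝ) / q else 0)
      (∑ q ∈ ⌊Real.exp V⌋₊.primesLE, if q ∈ ⌊Real.exp V⌋₊.primesLE then (1 : ℝ) / q else 0) :=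
    hasSum_sum_of_ne_finset_zero fun q hq => if_neg hq
  rw [Finset.sum_congr rfl fun q hq => if_pos (c := q ∈ ⌊Real.exp V⌋₊.primesLE) hq] at hsum3
  refine hasSum_le (fun n => ?_) ((hsum2.sub hsum3).mul_left _) hw.hasSum
  have hpow : 0 ≤ V ^ (k + 1) := by positivity
  have hwn : 0 ≤ if χ (n : ZMod p) = -1 then logWeight k δ n else 0 := by
    split_ifs
    exacts [logWeight_nonneg k δ n, le_rfl]
  by_cases hn : n.Prime ∧ χ (n : ZMod p) = -1
  · by_cases hnV : n ∈ ⌊Real.exp V⌋₊.primesLE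
    · refine le_trans (mul_nonpos_of_nonneg_of_nonpos hpow ?_) hwn
      rw [hf]
      simp only [if_pos hn, if_pos hnV]
      linarith [(rpow_neg_one_add_le_half hn.1 hδ.le).1]
    · rw [hf]
      simp only [if_pos hn, if_neg hnV, if_pos hn.2, sub_zero]
      have hlt : Real.exp V < n := by
        rw [Nat.mem_primesLE] at hnV
        by_contra! h
        exact hnV ⟨Nat.le_floor h, hn.1⟩
      have hlog : V ≤ Real.log n := by
        rw [Real.le_log_iff_exp_le ((Real.exp_pos V).trans hlt)]
        exact hlt.le
      rw [logWeight, ArithmeticFunction.vonMangoldt_apply_prime hn.1, ← pow_succ']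
      gcongr
  · refine le_trans (mul_nonpos_of_nonneg_of_nonpos hpow ?_) hwn
    rw [hf]
    simp only [if_neg hn]
    split_ifs
    · simp
    · simp

open Classical in
/-- A lower bound for the mass of the quadratic non-residues. -/
theorem exists_pow_le_tsum_ite_eq_neg_one :
    ∃ C : ℝ, 0 ≤ C ∧ ∀ {p : ℕ} [Fact p.Prime] {χ : DirichletCharacter ℂ p} {k : ℕ}
      {δ V η : ℝ}, χ ≠ 1 → χ ^ 2 = 1 → 0 < η → η ≤ 1 / 2 → 0 < δ → δ ≤ η → 1 ≤ V →
      1 / (2 * δ) ≤ ‖riemannZeta (1 + δ : ℝ)‖ →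
      3 * (Real.log V + C) + Real.log (8 * δ / η) + 2 * η * Real.log p ≤ 0 →
      V ^ (k + 1) ≤ ∑' n : ℕ, if χ (n : ZMod p) = -1 then logWeight k δ n else 0 := by
  obtain ⟨C, hC, hCV⟩ := exists_sum_one_div_primesLE_exp_le
  refine ⟨C + 1, by positivity, fun {p} _ {χ k δ V η} h1 h2 hη hη2 hδ hδη hV hζ hineq => ?_⟩
  have hp : p.Prime := Fact.out
  have hmain := mul_tsum_sub_sum_le χ k hδ (by linarith : 0 ≤ V)
  refine le_trans ?_ hmain
  refine le_mul_of_one_le_right (by positivity) ?_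
  have hz := norm_riemannZeta_le_mul_exp h2 hδ
  set S := ∑' q : Nat.Primes,
    if χ ((q : ℕ) : ZMod p) = -1 then ((q : ℕ) : ℝ) ^ (-(1 + δ)) else 0 with hS
  have hL := norm_LFunction_le h1 hp.ne_one hη hη2 (s := ((1 + δ : ℝ) : ℂ)) (by
    push_cast
    rw [add_sub_cancel_left, Complex.norm_real, Real.norm_of_nonneg hδ.le]
    exact hδη)
  have hpp : (0 : ℝ) < p := by exact_mod_cast hp.pos
  have hall : 1 / (2 * δ) ≤ 2 / η * (p : ℝ) ^ (2 * η) * (2 * Real.exp (3 * S)) :=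
    hζ.trans (hz.trans (by gcongr))
  have hlog : 1 ≤ 8 * δ / η * (p : ℝ) ^ (2 * η) * Real.exp (3 * S) := by
    have := mul_le_mul_of_nonneg_left hall (by positivity : 0 ≤ 2 * δ)
    rw [mul_one_div_cancel (by positivity)] at this
    refine this.trans (le_of_eq ?_)
    field_simp
    ring
  have hlog2 := Real.log_nonneg hlog
  rw [Real.log_mul (by positivity) (by positivity), Real.log_exp,
    Real.log_mul (by positivity) (by positivity), Real.log_rpow hpp] at hlog2
  linarith [hCV V hV]

end DirichletCharacter

namespace DirichletCharacter

variable {p : ℕ} [Fact p.Prime]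

theorem exists_pow_two_pow_eq_neg_one (hp : p ≠ 2) :
    ∃ (g : (ZMod p)ˣ) (t : ℕ) (χ : DirichletCharacter ℂ p), 2 ^ (t + 1) ∣ p - 1 ∧
      g ^ 2 ^ t = -1 ∧ χ ≠ 1 ∧ χ ^ 2 = 1 ∧ χ (g : ZMod p) = -1 ∧
      ∀ ψ : DirichletCharacter ℂ p, ψ ^ 2 = 1 → ψ = 1 ∨ ψ = χ := by
  have hpp : p.Prime := Fact.out
  obtain ⟨r, hr⟩ := IsCyclic.exists_generator (α := (ZMod p)ˣ)
  have hord : orderOf r = p - 1 := by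
    rw [orderOf_eq_card_of_forall_mem_zpowers hr, Nat.card_eq_fintype_card, ZMod.card_units]
  have hp1 : p - 1 ≠ 0 := by have := hpp.two_le; omega
  obtain ⟨s, m, hm, hsm⟩ := Nat.exists_eq_two_pow_mul_odd hp1
  have hs : s ≠ 0 := by
    rintro rfl
    obtain ⟨a, ha⟩ := hpp.odd_of_ne_two hp
    obtain ⟨b, hb⟩ := hm
    omega
  obtain ⟨t, rfl⟩ := Nat.exists_eq_succ_of_ne_zero hs
  set χ : DirichletCharacter ℂ p := (quadraticChar (ZMod p)).ringHomComp (Int.castRingHom ℂ)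
    with hχ
  have hχ1 : χ ≠ 1 := by
    rw [hχ, MulChar.ringHomComp_ne_one_iff Int.cast_injective]
    exact quadraticChar_ne_one (by rwa [ZMod.ringChar_zmod_n])
  have hχ2 : χ ^ 2 = 1 := by
    rw [← MulChar.isQuadratic_iff_sq_eq_one]
    exact (quadraticChar_isQuadratic (ZMod p)).comp _
  have hval : ∀ ψ : DirichletCharacter ℂ p, ψ ^ 2 = 1 → ψ ≠ 1 → ψ (r : ZMod p) = -1 := by
    intro ψ h2 h1
    rcases MulChar.isQuadratic_iff_sq_eq_one.2 h2 (r : ZMod p) with h | h | h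
    · exact absurd h (r.isUnit.map ψ).ne_zero
    · refine absurd ?_ h1
      rw [MulChar.eq_iff hr, h, MulChar.one_apply_coe]
    · exact h
  refine ⟨r ^ m, t, χ, ⟨m, hsm⟩, ?_, hχ1, hχ2, ?_, fun ψ hψ => ?_⟩
  · have h1 : ((r ^ m) ^ 2 ^ t) ^ 2 = 1 := by
      rw [← pow_mul, ← pow_mul, ← pow_succ, mul_comm, ← hsm, ← hord, pow_orderOf_eq_one]
    have h2 : (r ^ m) ^ 2 ^ t ≠ 1 := by
      rw [← pow_mul]
      refine pow_ne_one_of_lt_orderOf (Nat.mul_ne_zero hm.pos.ne' (by positivity)) ?_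
      rw [hord, hsm, pow_succ, mul_comm]
      exact Nat.mul_lt_mul_of_pos_right (by have := Nat.two_pow_pos t; omega) hm.pos
    rw [Units.ext_iff, sq, Units.val_mul, Units.val_one, mul_self_eq_one_iff] at h1
    rcases h1 with h1 | h1
    · exact absurd (Units.ext h1) h2
    · exact Units.ext h1
  · rw [Units.val_pow_eq_pow_val, map_pow, hval χ hχ2 hχ1, hm.neg_one_pow]
  · by_cases h : ψ = 1
    · exact Or.inl h
    · right
      rw [MulChar.eq_iff hr, hval ψ hψ h, hval χ hχ2 hχ1]

open Classical in
/-- Orthogonality of characters, isolating the characters of order at most two. -/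
theorem two_mul_tsum_sub_le {χ : DirichletCharacter ℂ p} {g : (ZMod p)ˣ} (hχ1 : χ ≠ 1)
    (hχ2 : χ ^ 2 = 1) (hg : χ (g : ZMod p) = -1)
    (huniq : ∀ ψ : DirichletCharacter ℂ p, ψ ^ 2 = 1 → ψ = 1 ∨ ψ = χ) {k : ℕ} {δ B : ℝ}
    (hδ : 0 < δ) (hB : 0 ≤ B)
    (hbound : ∀ ψ : DirichletCharacter ℂ p, ψ ≠ 1 → ψ ^ 2 ≠ 1 →
      ‖∑' n : ℕ, ψ (n : ZMod p) * (logWeight k δ n : ℂ)‖ ≤ B) :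
    2 * (∑' n : ℕ, if χ (n : ZMod p) = -1 then logWeight k δ n else 0) - p * B ≤
      p * ∑' n : ℕ, if (n : ZMod p) = g then logWeight k δ n else 0 := by
  have hpp : p.Prime := Fact.out
  have hS : ∀ ψ : DirichletCharacter ℂ p,
      Summable fun n : ℕ => ψ (n : ZMod p) * (logWeight k δ n : ℂ) := fun ψ => by
    refine Summable.of_norm_bounded (summable_logWeight k hδ) fun n => ?_
    rw [norm_mul, Complex.norm_real, Real.norm_of_nonneg (logWeight_nonneg k δ n)]
    exact mul_le_of_le_one_left (logWeight_nonneg k δ n) (ψ.norm_le_one _)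
  set N := ∑' n : ℕ, if χ (n : ZMod p) = -1 then logWeight k δ n else 0 with hN
  set T := ∑' n : ℕ, if (n : ZMod p) = g then logWeight k δ n else 0 with hT
  have hT0 : 0 ≤ T := tsum_nonneg fun n => by
    split_ifs
    exacts [logWeight_nonneg k δ n, le_rfl]
  have horth : ((((p - 1 : ℕ) : ℝ) * T : ℝ) : ℂ) = ∑ ψ : DirichletCharacter ℂ p,
      ψ (g : ZMod p)⁻¹ * ∑' n : ℕ, ψ (n : ZMod p) * (logWeight k δ n : ℂ) := by
    simp_rw [← tsum_mul_left]
    rw [← Summable.tsum_finsetSum fun ψ _ => (hS ψ).mul_left _, hT, ← tsum_mul_left,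
      Complex.ofReal_tsum]
    refine tsum_congr fun n => ?_
    simp_rw [← mul_assoc]
    rw [← Finset.sum_mul, DirichletCharacter.sum_char_inv_mul_char_eq ℂ g.isUnit,
      Nat.totient_prime hpp]
    by_cases h : (n : ZMod p) = g
    · rw [if_pos h, if_pos h.symm]
      push_cast
      rfl
    · rw [if_neg h, if_neg (Ne.symm h)]
      simp
  have hginv : χ (g : ZMod p)⁻¹ = -1 := by
    have h1 : χ (g : ZMod p)⁻¹ * χ (g : ZMod p) = 1 := by
      rw [← map_mul, inv_mul_cancel₀ g.ne_zero, map_one]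
    rw [hg] at h1
    linear_combination -h1
  have hginv1 : (1 : DirichletCharacter ℂ p) (g : ZMod p)⁻¹ = 1 :=
    MulChar.one_apply (g.isUnit.inv)
  have htwo : (∑' n : ℕ, (1 : DirichletCharacter ℂ p) (n : ZMod p) * (logWeight k δ n : ℂ)) -
      (∑' n : ℕ, χ (n : ZMod p) * (logWeight k δ n : ℂ)) = ((2 * N : ℝ) : ℂ) := by
    rw [← (hS 1).tsum_sub (hS χ), hN, ← tsum_mul_left, Complex.ofReal_tsum]
    refine tsum_congr fun n => ?_
    by_cases hu : IsUnit (n : ZMod p)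
    · rw [MulChar.one_apply hu]
      rcases MulChar.isQuadratic_iff_sq_eq_one.2 hχ2 (n : ZMod p) with h | h | h
      · exact absurd h (hu.map χ).ne_zero
      · rw [h, if_neg (by norm_num)]
        simp
      · rw [h, if_pos rfl]
        push_cast
        ring
    · rw [MulChar.map_nonunit _ hu, MulChar.map_nonunit _ hu, if_neg (by norm_num)]
      simp
  set F : DirichletCharacter ℂ p → ℂ := fun ψ =>
    ψ (g : ZMod p)⁻¹ * ∑' n : ℕ, ψ (n : ZMod p) * (logWeight k δ n : ℂ) with hF
  have hsplit : ∑ ψ : DirichletCharacter ℂ p, F ψ =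
      ((2 * N : ℝ) : ℂ) + ∑ ψ ∈ (Finset.univ.erase χ).erase 1, F ψ := by
    rw [← Finset.add_sum_erase _ F (Finset.mem_univ χ),
        ← Finset.add_sum_erase (Finset.univ.erase χ) F
      (Finset.mem_erase.2 ⟨hχ1.symm, Finset.mem_univ 1⟩), ← htwo]
    simp only [hF, hginv, hginv1]
    ring
  have hrest : ‖∑ ψ ∈ (Finset.univ.erase χ).erase 1, F ψ‖ ≤ p * B := by
    refine (norm_sum_le_of_le (f := F) (n := fun _ => B) _ fun ψ hψ => ?_).trans ?_
    · rw [Finset.mem_erase, Finset.mem_erase] at hψ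
      rw [hF, norm_mul]
      refine (mul_le_of_le_one_left (norm_nonneg _) (ψ.norm_le_one _)).trans
        (hbound ψ hψ.1 fun h => ?_)
      rcases huniq ψ h with h | h
      exacts [hψ.1 h, hψ.2.1 h]
    · rw [Finset.sum_const, nsmul_eq_mul]
      have hcard : ((Finset.univ.erase χ).erase 1).card ≤ p := by
        refine (Finset.card_le_univ _).trans ?_
        rw [← Nat.card_eq_fintype_card, card_eq_totient_of_hasEnoughRootsOfUnity]
        exact Nat.totient_le p
      gcongr
  rw [hsplit] at horth
  have hre := congrArg Complex.re horth
  rw [Complex.ofReal_re, Complex.add_re, Complex.ofReal_re] at hre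
  have h1 := neg_le_of_abs_le ((Complex.abs_re_le_norm _).trans hrest)
  have h2 : (((p - 1 : ℕ) : ℝ)) * T ≤ p * T := by
    have : (((p - 1 : ℕ) : ℝ)) ≤ p := by exact_mod_cast Nat.sub_le p 1
    gcongr
  linarith

end DirichletCharacter

theorem logWeight_le_factorial (k : ℕ) {δ : ℝ} (hδ : 0 ≤ δ) (n : ℕ) :
    logWeight k δ n ≤ (k + 1).factorial := by
  rcases n.eq_zero_or_pos with rfl | hn
  · simp [logWeight]
  have hn0 : (0 : ℝ) < n := by exact_mod_cast hn
  have hn1 : (1 : ℝ) ≤ n := by exact_mod_cast hn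
  have hlog := Real.log_natCast_nonneg n
  have h1 : (n : ℝ) ^ (-(1 + δ)) ≤ (n : ℝ)⁻¹ := by
    rw [← Real.rpow_neg_one]
    exact Real.rpow_le_rpow_of_exponent_le hn1 (by linarith)
  have h2 := Real.pow_div_factorial_le_exp (Real.log n) hlog (k + 1)
  rw [Real.exp_log hn0, div_le_iff₀ (by positivity)] at h2
  calc logWeight k δ n ≤ Real.log n * Real.log n ^ k * (n : ℝ)⁻¹ := by
        unfold logWeight
        gcongr
        exact ArithmeticFunction.vonMangoldt_le_log
    _ = Real.log n ^ (k + 1) / n := by rw [pow_succ', div_eq_mul_inv]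
    _ ≤ _ := by
      rw [div_le_iff₀ hn0]
      linarith

theorem logWeight_le_rpow (k : ℕ) {δ : ℝ} (hδ : 0 < δ) {n : ℕ} (hn : 1 / δ ^ 2 ≤ Real.log n) :
    logWeight k δ n ≤
      4 ^ (k + 1) * (2 * (k + 1)).factorial * (n : ℝ) ^ (-(1 + δ / 2)) := by
  have hlog : 0 < Real.log n := lt_of_lt_of_le (by positivity) hn
  have hn0 : (0 : ℝ) < n := by
    rcases n.eq_zero_or_pos with rfl | h
    · simp at hlog
    · exact_mod_cast h
  set u := Real.log n with hu
  set w := δ / 2 * u with hw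
  have huw : u ≤ 4 * w ^ 2 := by
    rw [div_le_iff₀ (by positivity)] at hn
    rw [hw]
    nlinarith
  have h2 := Real.pow_div_factorial_le_exp w (by positivity) (2 * (k + 1))
  rw [div_le_iff₀ (by positivity)] at h2
  have hexp : Real.exp w = (n : ℝ) ^ (δ / 2) := by
    rw [Real.rpow_def_of_pos hn0, mul_comm]
  have h3 : u ^ (k + 1) ≤ 4 ^ (k + 1) * ((n : ℝ) ^ (δ / 2) * (2 * (k + 1)).factorial) := by
    calc u ^ (k + 1) ≤ (4 * w ^ 2) ^ (k + 1) := by gcongr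
      _ = 4 ^ (k + 1) * w ^ (2 * (k + 1)) := by rw [mul_pow, ← pow_mul]
      _ ≤ _ := by rw [← hexp]; gcongr
  calc logWeight k δ n ≤ u * u ^ k * (n : ℝ) ^ (-(1 + δ)) := by
        unfold logWeight
        gcongr
        exact ArithmeticFunction.vonMangoldt_le_log
    _ = u ^ (k + 1) * (n : ℝ) ^ (-(1 + δ)) := by rw [pow_succ']
    _ ≤ 4 ^ (k + 1) * ((n : ℝ) ^ (δ / 2) * (2 * (k + 1)).factorial) * (n : ℝ) ^ (-(1 + δ)) := by
        gcongr
    _ = 4 ^ (k + 1) * (2 * (k + 1)).factorial * ((n : ℝ) ^ (δ / 2) * (n : ℝ) ^ (-(1 + δ))) := by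
        ring
    _ = _ := by
        rw [← Real.rpow_add hn0]
        congr 2
        ring

theorem tsum_ite_logWeight_le {P : ℕ → Prop} [DecidablePred P] (k : ℕ) {δ : ℝ} (hδ : 0 < δ)
    {F : Finset ℕ}
    (hP : ∀ n, P n → ArithmeticFunction.vonMangoldt n ≠ 0 → Real.log n < 1 / δ ^ 2 → n ∈ F) :
    (∑' n : ℕ, if P n then logWeight k δ n else 0) ≤ F.card * (k + 1).factorial +
      4 ^ (k + 1) * (2 * (k + 1)).factorial * ‖riemannZeta (1 + δ / 2 : ℝ)‖ := by
  have h1 : HasSum (fun n : ℕ => if n ∈ F then ((k + 1).factorial : ℝ) else 0)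
      (∑ n ∈ F, if n ∈ F then ((k + 1).factorial : ℝ) else 0) :=
    hasSum_sum_of_ne_finset_zero fun n hn => if_neg hn
  rw [Finset.sum_congr rfl fun n hn => if_pos (c := n ∈ F) hn, Finset.sum_const,
    nsmul_eq_mul] at h1
  have h2 : Summable fun n : ℕ => (n : ℝ) ^ (-(1 + δ / 2)) :=
    Real.summable_nat_rpow.2 (by linarith)
  have h3 := h2.hasSum.mul_left (4 ^ (k + 1) * ((2 * (k + 1)).factorial : ℝ))
  rw [tsum_rpow_eq_norm_riemannZeta (by positivity)] at h3
  refine hasSum_le (fun n => ?_)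
    (DirichletCharacter.summable_ite_logWeight P k hδ).hasSum (h1.add h3)
  have hr : 0 ≤ 4 ^ (k + 1) * ((2 * (k + 1)).factorial : ℝ) * (n : ℝ) ^ (-(1 + δ / 2)) := by
    positivity
  have hl : 0 ≤ if n ∈ F then ((k + 1).factorial : ℝ) else 0 := by split_ifs <;> positivity
  by_cases hPn : P n
  · rw [if_pos hPn]
    by_cases hΛ : ArithmeticFunction.vonMangoldt n = 0
    · rw [logWeight, hΛ, zero_mul, zero_mul]
      positivity
    by_cases hlog : Real.log n < 1 / δ ^ 2
    · rw [if_pos (hP n hPn hΛ hlog)]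
      linarith [logWeight_le_factorial k hδ.le n]
    · linarith [logWeight_le_rpow k hδ (not_lt.1 hlog)]
  · rw [if_neg hPn]
    positivity

theorem eventually_exists_unit_pow_le_tsum {m : ℕ} (hm : 0 < m) :
    ∀ᶠ A : ℝ in atTop, ∀ (p : ℕ) [Fact p.Prime], p ≠ 2 → (p : ℝ) ≤ A ^ m →
      ∃ (g : (ZMod p)ˣ) (t : ℕ), 2 ^ (t + 1) ∣ p - 1 ∧ g ^ 2 ^ t = -1 ∧
        A ^ (6 * m) ≤ ∑' n : ℕ,
          if (n : ZMod p) = g then logWeight (6 * m - 1) (1 / A ^ 16) n else 0 := by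
  obtain ⟨C, hC, hquad⟩ := DirichletCharacter.exists_pow_le_tsum_ite_eq_neg_one
  have hm0 : (0 : ℝ) < m := by exact_mod_cast hm
  have hm1 : (1 : ℝ) ≤ m := by exact_mod_cast hm
  set η : ℝ := 1 / (100 * m) with hη
  have hη0 : 0 < η := by positivity
  have hη2 : η ≤ 1 / 2 := by
    rw [hη]
    gcongr
    linarith
  have hηm : η * m = 1 / 100 := by rw [hη]; field_simp
  have hinv : Tendsto (fun A : ℝ => 1 / A) atTop (nhdsWithin 0 (Set.Ioi 0)) := by
    simpa only [one_div] using tendsto_inv_atTop_nhdsGT_zero (𝕜 := ℝ)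
  have hinv16 : Tendsto (fun A : ℝ => 1 / A ^ 16) atTop (nhdsWithin 0 (Set.Ioi 0)) :=
    hinv.comp (tendsto_pow_atTop (by norm_num))
  have hrpow : Tendsto (fun A : ℝ => A ^ ((9 : ℝ) / 10)) atTop atTop :=
    tendsto_rpow_atTop (by norm_num)
  filter_upwards [eventually_ge_atTop 1, eventually_ge_atTop (4 / η),
    hinv.eventually eventually_norm_riemannZeta_bounds,
    hinv16.eventually eventually_norm_riemannZeta_bounds,
    hrpow.eventually_ge_atTop (10368 * (4 / η ^ 2) ^ 5),
    Real.tendsto_log_atTop.eventually_ge_atTop (3 * C + Real.log (8 / η)),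
    eventually_ge_atTop ((6 * m - 1).factorial : ℝ)]
    with A hA1 hAη hζR hζδ hApow hAlog hAfac p _ hp2 hpA
  have hA0 : 0 < A := by linarith
  have hpp : p.Prime := Fact.out
  have hp0 : (0 : ℝ) < p := by exact_mod_cast hpp.pos
  obtain ⟨g, t, χ, hdvd, hg, hχ1, hχ2, hχg, huniq⟩ :=
    DirichletCharacter.exists_pow_two_pow_eq_neg_one hp2
  refine ⟨g, t, hdvd, hg, ?_⟩
  have hk : 6 * m - 1 + 1 = 6 * m := by omega
  have hδ0 : 0 < 1 / A ^ 16 := by positivity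
  have hδR : 1 / A ^ 16 ≤ 1 / A := by
    gcongr
    exact le_self_pow₀ hA1 (by norm_num)
  have hR4 : 4 * (1 / A) ≤ η := by
    rw [div_le_iff₀ hη0] at hAη
    rw [mul_one_div, div_le_iff₀ hA0]
    linarith
  have hlogp : Real.log p ≤ m * Real.log A := by
    rw [← Real.log_pow]
    exact Real.log_le_log hp0 hpA
  have hlogA := Real.log_nonneg hA1
  have hppow : ((p : ℝ) ^ (2 * η)) ^ 5 ≤ A ^ ((1 : ℝ) / 10) := by
    calc ((p : ℝ) ^ (2 * η)) ^ 5 ≤ ((A ^ m) ^ (2 * η)) ^ 5 := by gcongr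
      _ = A ^ ((1 : ℝ) / 10) := by
        rw [← Real.rpow_natCast A m, ← Real.rpow_mul hA0.le, ← Real.rpow_natCast _ 5,
          ← Real.rpow_mul hA0.le]
        congr 1
        push_cast
        linear_combination 10 * hηm
  have hRN : 10368 * (1 / A) * (4 / η ^ 2 * (p : ℝ) ^ (2 * η)) ^ 5 ≤ 1 := by
    have hsplit : A = A ^ ((9 : ℝ) / 10) * A ^ ((1 : ℝ) / 10) := by
      rw [← Real.rpow_add hA0]
      norm_num
    rw [mul_pow]
    calc 10368 * (1 / A) * ((4 / η ^ 2) ^ 5 * ((p : ℝ) ^ (2 * η)) ^ 5)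
        = 10368 * (4 / η ^ 2) ^ 5 * ((p : ℝ) ^ (2 * η)) ^ 5 / A := by ring
      _ ≤ A ^ ((9 : ℝ) / 10) * A ^ ((1 : ℝ) / 10) / A := by gcongr
      _ = 1 := by rw [← hsplit, div_self hA0.ne']
  have hN := hquad (p := p) (χ := χ) (k := 6 * m - 1) (δ := 1 / A ^ 16) (V := A ^ 2) (η := η)
    hχ1 hχ2 hη0 hη2 hδ0 (by linarith) (one_le_pow₀ hA1) hζδ.1 (by
      have h1 : Real.log (8 * (1 / A ^ 16) / η) = Real.log (8 / η) - 16 * Real.log A := by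
        rw [show 8 * (1 / A ^ 16) / η = 8 / η / A ^ 16 by ring,
          Real.log_div (by positivity) (by positivity), Real.log_pow]
        push_cast
        rfl
      have h2 : 2 * η * Real.log p ≤ 2 * η * (m * Real.log A) := by gcongr
      have h3 : 2 * η * (m * Real.log A) = 1 / 50 * Real.log A := by
        linear_combination 2 * Real.log A * hηm
      rw [h1, Real.log_pow]
      push_cast
      linarith)
  rw [hk] at hN
  have hmain := DirichletCharacter.two_mul_tsum_sub_le hχ1 hχ2 hχg huniq (k := 6 * m - 1)
    (δ := 1 / A ^ 16) (B := (6 * m - 1).factorial * A ^ (6 * m)) hδ0 (by positivity)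
    fun ψ hψ1 hψ2 => by
      have := DirichletCharacter.norm_tsum_mul_logWeight_le hψ1 hψ2 hpp.ne_one
        (by positivity : 0 < 1 / A) hη0 hη2 hR4 hζR.2 hRN hδ0 hδR (6 * m - 1)
      rwa [hk, one_div_pow, div_div_eq_mul_div, div_one] at this
  have hfac : (p : ℝ) * ((6 * m - 1).factorial * A ^ (6 * m)) ≤ A ^ (12 * m) := by
    calc (p : ℝ) * ((6 * m - 1).factorial * A ^ (6 * m)) ≤ A ^ m * (A ^ m * A ^ (6 * m)) := by
          gcongr
          exact hAfac.trans (le_self_pow₀ hA1 hm.ne')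
      _ = A ^ (8 * m) := by ring
      _ ≤ A ^ (12 * m) := pow_le_pow_right₀ hA1 (by omega)
  have hVpow : (A ^ 2) ^ (6 * m) = A ^ (12 * m) := by rw [← pow_mul]; congr 1; ring
  rw [hVpow] at hN
  have hpow : A ^ m * A ^ (6 * m) ≤ A ^ (12 * m) := by
    rw [← pow_add]
    exact pow_le_pow_right₀ hA1 (by omega)
  have hpT : A ^ m * A ^ (6 * m) ≤ A ^ m * ∑' n : ℕ,
      if (n : ZMod p) = g then logWeight (6 * m - 1) (1 / A ^ 16) n else 0 := by
    have hT0 : 0 ≤ ∑' n : ℕ,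
        if (n : ZMod p) = g then logWeight (6 * m - 1) (1 / A ^ 16) n else 0 :=
      tsum_nonneg fun n => by
        split_ifs
        exacts [logWeight_nonneg _ _ n, le_rfl]
    have := mul_le_mul_of_nonneg_right hpA hT0
    linarith
  exact le_of_mul_le_mul_left hpT (by positivity)

/-- Prime powers in suitable residue classes modulo `p`, avoiding a given set of primes. -/
theorem eventually_exists_prime_pow {m : ℕ} (hm : 32 ≤ m) :
    ∀ᶠ A : ℝ in atTop, ∀ p : ℕ, p.Prime → p ≠ 2 → (p : ℝ) ≤ A ^ m →
      ∀ E : Finset ℕ, (E.card : ℝ) ≤ A ^ m →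
        ∃ l j t : ℕ, l.Prime ∧ l ∉ E ∧ j ≠ 0 ∧ A ^ (2 * m) ≤ ((l ^ j : ℕ) : ℝ) ∧
          Real.log ((l ^ j : ℕ) : ℝ) ≤ A ^ 32 ∧ 2 ^ (t + 1) ∣ p - 1 ∧
          p ∣ (l ^ j) ^ 2 ^ t + 1 := by
  classical
  have hinv : Tendsto (fun A : ℝ => 1 / A ^ 16 / 2) atTop (nhdsWithin 0 (Set.Ioi 0)) := by
    have h : Tendsto (fun A : ℝ => (A ^ 16 * 2)⁻¹) atTop (nhdsWithin 0 (Set.Ioi 0)) :=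
      tendsto_inv_atTop_nhdsGT_zero.comp
        ((tendsto_pow_atTop (by norm_num)).atTop_mul_const two_pos)
    refine h.congr fun A => ?_
    rw [mul_inv, one_div, div_eq_mul_inv]
  set D : ℝ := 5 * (6 * m - 1 + 1).factorial +
    4 ^ (6 * m - 1 + 1) * (2 * (6 * m - 1 + 1)).factorial * 4 with hD
  filter_upwards [eventually_exists_unit_pow_le_tsum (by omega : 0 < m), eventually_ge_atTop 1,
    hinv.eventually eventually_norm_riemannZeta_bounds, eventually_gt_atTop D]
    with A hA hA1 hζ hAD p hp hp2 hpA E hE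
  have hA0 : 0 < A := by linarith
  have : Fact p.Prime := ⟨hp⟩
  obtain ⟨g, t, hdvd, hg, hT⟩ := hA p hp2 hpA
  by_contra! hcon
  set J := ⌊2 * A ^ 32⌋₊ + 1 with hJ
  set F : Finset ℕ := Finset.range ⌈A ^ (2 * m)⌉₊ ∪
    (E ×ˢ Finset.range J).image (fun x => x.1 ^ x.2) with hF
  have hupper := tsum_ite_logWeight_le (P := fun n : ℕ => (n : ZMod p) = g) (6 * m - 1)
    (by positivity : 0 < 1 / A ^ 16) (F := F) (by
      intro n hn hΛ hlog
      rw [ArithmeticFunction.vonMangoldt_ne_zero_iff, isPrimePow_nat_iff] at hΛ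
      obtain ⟨l, j, hl, hj, rfl⟩ := hΛ
      have hlog' : Real.log ((l ^ j : ℕ) : ℝ) < A ^ 32 := by
        refine hlog.trans_le (le_of_eq ?_)
        field_simp
      rw [hF, Finset.mem_union, Finset.mem_range, Finset.mem_image]
      by_contra! hmem
      refine hcon l j t hl (fun hlE => ?_) hj.ne' (Nat.ceil_le.1 hmem.1) hlog'.le hdvd ?_
      · refine hmem.2 (l, j) ?_ rfl
        rw [Finset.mem_product, Finset.mem_range, hJ]
        refine ⟨hlE, Nat.lt_succ_of_le (Nat.le_floor ?_)⟩
        have h2 : Real.log 2 ≤ Real.log l :=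
          Real.log_le_log two_pos (by exact_mod_cast hl.two_le)
        rw [Nat.cast_pow, Real.log_pow] at hlog'
        have hj0 : (0 : ℝ) ≤ j := Nat.cast_nonneg j
        nlinarith [Real.log_two_gt_d9]
      · rw [← ZMod.natCast_eq_zero_iff]
        push_cast
        have hgv := congrArg Units.val hg
        rw [Units.val_pow_eq_pow_val, Units.val_neg, Units.val_one, ← hn] at hgv
        push_cast at hgv
        rw [hgv, neg_add_cancel])
  have hpow : ∀ {i : ℕ}, i ≤ 2 * m → A ^ i ≤ A ^ (2 * m) := fun hi => pow_le_pow_right₀ hA1 hi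
  have hone : 1 ≤ A ^ (2 * m) := one_le_pow₀ hA1
  have hcard : (F.card : ℝ) ≤ 5 * A ^ (2 * m) := by
    have h1 : F.card ≤ ⌈A ^ (2 * m)⌉₊ + E.card * J := by
      refine (Finset.card_union_le _ _).trans ?_
      rw [Finset.card_range]
      gcongr
      refine Finset.card_image_le.trans ?_
      rw [Finset.card_product, Finset.card_range]
    have h2 : (F.card : ℝ) ≤ ⌈A ^ (2 * m)⌉₊ + E.card * J := by exact_mod_cast h1
    have h3 := (Nat.ceil_lt_add_one (by positivity : 0 ≤ A ^ (2 * m))).le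
    have h4 : (J : ℝ) ≤ 2 * A ^ 32 + 1 := by
      rw [hJ]
      push_cast
      linarith [Nat.floor_le (by positivity : 0 ≤ 2 * A ^ 32)]
    have h5 : (E.card : ℝ) * J ≤ A ^ m * (2 * A ^ 32 + 1) := by gcongr
    have h6 : A ^ m * A ^ 32 ≤ A ^ (2 * m) := by
      rw [← pow_add]
      exact hpow (by omega)
    have h7 := hpow (i := m) (by omega)
    linarith
  have hζ' : ‖riemannZeta (1 + 1 / A ^ 16 / 2 : ℝ)‖ ≤ 4 * A ^ (2 * m) := by
    refine hζ.2.trans ?_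
    have := hpow (i := 16) (by omega)
    calc 2 / (1 / A ^ 16 / 2) = 4 * A ^ 16 := by field_simp; norm_num
      _ ≤ _ := by linarith
  have hDA : A ^ (6 * m) ≤ D * A ^ (2 * m) := by
    refine (hT.trans hupper).trans ?_
    calc _ ≤ 5 * A ^ (2 * m) * (6 * m - 1 + 1).factorial + 4 ^ (6 * m - 1 + 1) *
          (2 * (6 * m - 1 + 1)).factorial * (4 * A ^ (2 * m)) := by gcongr
      _ = D * A ^ (2 * m) := by rw [hD]; ring
  have hlt : D * A ^ (2 * m) < A ^ (6 * m) := by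
    calc D * A ^ (2 * m) < A * A ^ (2 * m) := by gcongr
      _ = A ^ (2 * m + 1) := by ring
      _ ≤ A ^ (6 * m) := pow_le_pow_right₀ hA1 (by omega)
  linarith

theorem usigma_mul_prime_pow {n l a : ℕ} (hl : l.Prime) (ha : a ≠ 0) (hln : n.Coprime l) :
    usigma (n * l ^ a) = usigma n * (l ^ a + 1) := by
  have hco : n.Coprime (l ^ a) := hln.pow_right a
  rw [usigma, Nat.factorization_mul_of_coprime hco, Finsupp.prod_add_index_of_disjoint
    (by simpa only [Nat.support_factorization] using hco.disjoint_primeFactors), ← usigma,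
        hl.factorization_pow, Finsupp.prod,
    Finsupp.support_single _ ha, Finset.prod_singleton, Finsupp.single_eq_same]

theorem sum_two_pow_ite_dvd_le {Y : ℕ} {S : Finset ℕ} (hS : ∀ p ∈ S, 2 ≤ p ∧ p ≤ Y) (L : ℕ) :
    ∑ p ∈ S, ∑ i ∈ Finset.range L, (if 2 ^ i ∣ p - 1 then 2 ^ i else 0) ≤ L * Y := by
  rw [Finset.sum_comm]
  have h : ∀ i ∈ Finset.range L, ∑ p ∈ S, (if 2 ^ i ∣ p - 1 then 2 ^ i else 0) ≤ Y := by
    intro i _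
    rw [← Finset.sum_filter, Finset.sum_const, smul_eq_mul]
    have hcard : (S.filter fun p => 2 ^ i ∣ p - 1).card ≤ Y / 2 ^ i := by
      rw [← Nat.Ioc_filter_dvd_card_eq_div]
      refine Finset.card_le_card_of_injOn (fun p => p - 1) (fun p hp => ?_) fun p hp q hq hpq => ?_
      · rw [Finset.mem_coe, Finset.mem_filter] at hp
        have := hS p hp.1
        rw [Finset.mem_coe, Finset.mem_filter, Finset.mem_Ioc]
        exact ⟨⟨Nat.sub_pos_of_lt this.1, (Nat.sub_le p 1).trans this.2⟩, hp.2⟩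
      · rw [Finset.mem_coe, Finset.mem_filter] at hp hq
        have h1 := hS p hp.1
        have h2 := hS q hq.1
        simp only at hpq
        omega
    exact (Nat.mul_le_mul_right _ hcard).trans (Nat.div_mul_le_self _ _)
  simpa using Finset.sum_le_card_nsmul _ _ _ h

/-- An integer whose `usigma` is divisible by prescribed primes. -/
theorem exists_forall_dvd_usigma {S : Finset ℕ} {B Q : ℝ} {L : ℕ} (hQ : 0 < Q)
    (hS : ∀ p ∈ S, ∀ E : Finset ℕ, E.card ≤ S.card → ∃ l j t : ℕ, l.Prime ∧ l ∉ E ∧ j ≠ 0 ∧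
      Q ≤ ((l ^ j : ℕ) : ℝ) ∧ Real.log ((l ^ j : ℕ) : ℝ) ≤ B ∧ t < L ∧ 2 ^ t ∣ p - 1 ∧
        p ∣ (l ^ j) ^ 2 ^ t + 1) (hB : 0 ≤ B) {T : Finset ℕ} (hT : T ⊆ S) :
    ∃ n : ℕ, n ≠ 0 ∧ ¬ 2 ∣ n ∧ n.primeFactors.card ≤ T.card ∧ (∀ p ∈ T, p ∣ usigma n) ∧
      (T.Nonempty → 2 ∣ usigma n ∧ Q ≤ n) ∧ (usigma n : ℝ) ≤ n * (1 + 1 / Q) ^ T.card ∧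
      Real.log n ≤
        B * (∑ p ∈ T, ∑ i ∈ Finset.range L, if 2 ^ i ∣ p - 1 then 2 ^ i else 0 : ℕ) := by
  classical
  induction T using Finset.induction_on with
  | empty => exact ⟨1, by simp [usigma]⟩
  | insert p T hpT ih =>
    obtain ⟨n, hn0, hn2, hcard, hdvd, -, hup, hlog⟩ := ih ((Finset.subset_insert p T).trans hT)
    have hTS : T.card + 1 ≤ S.card := by
      rw [← Finset.card_insert_of_notMem hpT]
      exact Finset.card_le_card hT
    obtain ⟨l, j, t, hl, hlE, hj, hlQ, hlB, htL, ht, hpl⟩ :=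
      hS p (hT (Finset.mem_insert_self p T)) (insert 2 n.primeFactors)
        ((Finset.card_insert_le _ _).trans (by omega))
    rw [Finset.mem_insert, not_or, Nat.mem_primeFactors_of_ne_zero hn0] at hlE
    have hln : ¬ l ∣ n := fun h => hlE.2 ⟨hl, h⟩
    have hco : n.Coprime l := ((Nat.Prime.coprime_iff_not_dvd hl).2 hln).symm
    have ha : j * 2 ^ t ≠ 0 := by positivity
    have hq0 : 0 < l ^ j := pow_pos hl.pos j
    rw [← pow_mul] at hpl
    have hus := usigma_mul_prime_pow hl ha hco
    have hlodd : Odd (l ^ (j * 2 ^ t)) := (hl.odd_of_ne_two hlE.1).pow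
    have hQle : Q ≤ ((l ^ (j * 2 ^ t) : ℕ) : ℝ) := by
      refine hlQ.trans ?_
      exact_mod_cast Nat.pow_le_pow_right hl.pos (Nat.le_mul_of_pos_right j (by positivity))
    have hw : (2 : ℝ) ^ t ≤
        ((∑ i ∈ Finset.range L, if 2 ^ i ∣ p - 1 then 2 ^ i else 0 : ℕ) : ℝ) := by
      have := Finset.single_le_sum (f := fun i => if 2 ^ i ∣ p - 1 then 2 ^ i else 0)
        (fun i _ => Nat.zero_le _) (Finset.mem_range.2 htL)
      simp only [if_pos ht] at this
      exact_mod_cast this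
    have hn0' : (0 : ℝ) < n := by exact_mod_cast Nat.pos_of_ne_zero hn0
    have hq0' : (0 : ℝ) < ((l ^ (j * 2 ^ t) : ℕ) : ℝ) := by
      exact_mod_cast pow_pos hl.pos _
    refine ⟨n * l ^ (j * 2 ^ t), Nat.mul_ne_zero hn0 (pow_pos hl.pos _).ne', ?_, ?_, ?_, ?_, ?_, ?_⟩
    · rw [Nat.prime_two.dvd_mul, not_or]
      exact ⟨hn2, hlodd.not_two_dvd_nat⟩
    · rw [hco.pow_right (j * 2 ^ t) |>.primeFactors_mul, Finset.card_insert_of_notMem hpT,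
        Nat.primeFactors_prime_pow ha hl]
      refine (Finset.card_union_le _ _).trans ?_
      rw [Finset.card_singleton]
      omega
    · intro q hq
      rw [hus]
      rcases Finset.mem_insert.1 hq with rfl | hq
      · exact hpl.mul_left _
      · exact (hdvd q hq).mul_right _
    · refine fun _ => ⟨?_, ?_⟩
      · rw [hus]
        exact (hlodd.add_one).two_dvd.mul_left _
      · push_cast
        push_cast at hQle
        refine hQle.trans (le_mul_of_one_le_left (by positivity) ?_)
        exact_mod_cast Nat.one_le_iff_ne_zero.2 hn0
    · rw [hus, Finset.card_insert_of_notMem hpT, pow_succ, Nat.cast_mul, Nat.cast_mul,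
        Nat.cast_add, Nat.cast_one]
      have hstep : ((l ^ (j * 2 ^ t) : ℕ) : ℝ) + 1 ≤ (l ^ (j * 2 ^ t) : ℕ) * (1 + 1 / Q) := by
        rw [mul_add, mul_one, mul_one_div]
        gcongr
        rwa [one_le_div hQ]
      calc (usigma n : ℝ) * ((l ^ (j * 2 ^ t) : ℕ) + 1)
          ≤ n * (1 + 1 / Q) ^ T.card * ((l ^ (j * 2 ^ t) : ℕ) * (1 + 1 / Q)) := by gcongr
        _ = _ := by ring
    · rw [Nat.cast_mul, Real.log_mul hn0'.ne' hq0'.ne', Finset.sum_insert hpT, Nat.cast_add,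
        mul_add, add_comm]
      refine add_le_add ?_ hlog
      rw [pow_mul, Nat.cast_pow, Real.log_pow, mul_comm]
      refine (mul_le_mul_of_nonneg_right hlB (by positivity)).trans ?_
      push_cast at hw ⊢
      gcongr

theorem totient_le_mul_mertensProd {x : ℝ} {m : ℕ} (hm : ∀ p ∈ ⌊x⌋₊.primesLE, p ∣ m) (hm0 : m ≠ 0) :
    (m.totient : ℝ) ≤ m * mertensProd x := by
  rw [totient_eq_mul_prod_one_sub, mertensProd]
  refine mul_le_mul_of_nonneg_left ?_ (Nat.cast_nonneg m)
  refine Finset.prod_le_prod_of_subset_of_le_one (fun p hp => ?_) (fun p hp => ?_)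
    fun p hp _ => ?_
  · exact Nat.mem_primeFactors.2 ⟨Nat.prime_of_mem_primesLE hp, hm p hp, hm0⟩
  · exact (one_sub_one_div_prime_pos (Nat.prime_of_mem_primeFactors hp)).le
  · exact sub_le_self _ (by positivity)

theorem exists_totient_usigma_le {m : ℕ} (hm : 32 ≤ m) :
    ∀ᶠ A : ℝ in atTop, ∃ n : ℕ, A ≤ n ∧
      (Nat.totient (usigma n) : ℝ) * Real.log (Real.log n) / n ≤
        Real.exp (1 / A ^ m) * mertensProd (A ^ m) * ((m + 33) * Real.log A) := by
  have hloglog : ∀ᶠ A : ℝ in atTop, m * Real.log A / Real.log 2 + 1 ≤ A := by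
    have h : Tendsto (fun A : ℝ => m / Real.log 2 * (Real.log A / A) + 1 / A) atTop
        (nhds (m / Real.log 2 * 0 + 0)) :=
      ((Real.isLittleO_log_id_atTop.tendsto_div_nhds_zero).const_mul _).add
        (tendsto_const_nhds.div_atTop tendsto_id)
    rw [mul_zero, add_zero] at h
    filter_upwards [h.eventually_lt_const one_pos, eventually_gt_atTop 0] with A hA hA0
    have := mul_le_mul_of_nonneg_right hA.le hA0.le
    field_simp at this ⊢
    linarith
  filter_upwards [eventually_exists_prime_pow hm, eventually_ge_atTop 3, hloglog]
    with A hA hA3 hAlog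
  have hA0 : 0 < A := by linarith
  have hA1 : 1 ≤ A := by linarith
  have hAm : 3 ≤ A ^ m := hA3.trans (le_self_pow₀ hA1 (by omega))
  set Y := ⌊A ^ m⌋₊ with hY
  have hYA : (Y : ℝ) ≤ A ^ m := Nat.floor_le (by positivity)
  have hY3 : 3 ≤ Y := Nat.le_floor (by exact_mod_cast hAm)
  set S := Y.primesLE.erase 2 with hS
  have hmemS : ∀ p ∈ S, p ≠ 2 ∧ p ≤ Y ∧ p.Prime := fun p hp => by
    rwa [hS, Finset.mem_erase, Nat.mem_primesLE] at hp
  have hScard : S.card ≤ Y := by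
    have hsub : S ⊆ Finset.Ioc 0 Y := fun p hp => by
      have := hmemS p hp
      exact Finset.mem_Ioc.2 ⟨this.2.2.pos, this.2.1⟩
    simpa using Finset.card_le_card hsub
  have hScard' : (S.card : ℝ) ≤ A ^ m := le_trans (by exact_mod_cast hScard) hYA
  set L := Nat.log 2 Y + 1 with hL
  have hLA : (L : ℝ) ≤ A := by
    refine le_trans ?_ hAlog
    rw [hL, Nat.cast_add, Nat.cast_one]
    have h1 : (Nat.log 2 Y : ℝ) ≤ Real.logb 2 Y := by exact_mod_cast Real.natLog_le_logb Y 2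
    have h2 : Real.logb 2 Y ≤ m * Real.log A / Real.log 2 := by
      rw [Real.logb, ← Real.log_pow]
      have : (0 : ℝ) < Y := by exact_mod_cast (by omega : 0 < Y)
      gcongr
    linarith
  obtain ⟨n, hn0, -, -, hdvd, hne, hup, hlog⟩ := exists_forall_dvd_usigma (S := S) (B := A ^ 32)
    (Q := A ^ (2 * m)) (L := L) (by positivity) (fun p hp E hE => by
      obtain ⟨hp2, hpY, hpp⟩ := hmemS p hp
      have hpA : (p : ℝ) ≤ A ^ m := le_trans (by exact_mod_cast hpY) hYA
      obtain ⟨l, j, t, h1, h2, h3, h4, h5, h6, h7⟩ :=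
        hA p hpp hp2 hpA E (le_trans (by exact_mod_cast hE) hScard')
      refine ⟨l, j, t, h1, h2, h3, h4, h5, ?_, (pow_dvd_pow 2 (Nat.le_succ t)).trans h6, h7⟩
      have hpos : 0 < p - 1 := Nat.sub_pos_of_lt hpp.one_lt
      have h8 := Nat.le_of_dvd hpos h6
      rw [hL]
      refine Nat.lt_succ_of_le (Nat.le_log_of_pow_le one_lt_two ?_)
      rw [pow_succ] at h8
      omega) (by positivity) subset_rfl
  have hSne : S.Nonempty := ⟨3, by
    rw [hS, Finset.mem_erase, Nat.mem_primesLE]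
    exact ⟨by norm_num, hY3, Nat.prime_three⟩⟩
  obtain ⟨h2, hQn⟩ := hne hSne
  have hn0' : (0 : ℝ) < n := by exact_mod_cast Nat.pos_of_ne_zero hn0
  have hAn : A ≤ n := (le_self_pow₀ hA1 (by omega)).trans hQn
  refine ⟨n, hAn, ?_⟩
  have hall : ∀ p ∈ ⌊A ^ m⌋₊.primesLE, p ∣ usigma n := fun p hp => by
    by_cases hp2 : p = 2
    · exact hp2 ▸ h2
    · exact hdvd p (Finset.mem_erase.2 ⟨hp2, hp⟩)
  have hus0 : usigma n ≠ 0 := (Nat.pos_of_ne_zero hn0 |>.trans_le (le_usigma n)).ne'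
  have htot := totient_le_mul_mertensProd hall hus0
  have hexp : (usigma n : ℝ) ≤ n * Real.exp (1 / A ^ m) := by
    refine hup.trans ?_
    gcongr
    calc (1 + 1 / A ^ (2 * m)) ^ S.card ≤ Real.exp (1 / A ^ (2 * m)) ^ S.card := by
          gcongr
          rw [add_comm]
          exact Real.add_one_le_exp _
      _ = Real.exp (S.card * (1 / A ^ (2 * m))) := by rw [← Real.exp_nat_mul]
      _ ≤ Real.exp (A ^ m * (1 / A ^ (2 * m))) := by gcongr
      _ = Real.exp (1 / A ^ m) := by
        congr 1
        rw [two_mul, pow_add]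
        field_simp
  have hlogn : Real.log n ≤ A ^ (m + 33) := by
    refine hlog.trans ?_
    have hsum := sum_two_pow_ite_dvd_le (Y := Y) (S := S) (fun p hp =>
      ⟨(hmemS p hp).2.2.two_le, (hmemS p hp).2.1⟩) L
    calc A ^ 32 * ((∑ p ∈ S, ∑ i ∈ Finset.range L, if 2 ^ i ∣ p - 1 then 2 ^ i else 0 : ℕ) : ℝ)
        ≤ A ^ 32 * ((L * Y : ℕ) : ℝ) := by gcongr
      _ = A ^ 32 * (L * Y) := by push_cast; rfl
      _ ≤ A ^ 32 * (A * A ^ m) := by gcongr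
      _ = A ^ (m + 33) := by ring
  have hlogn0 : 0 < Real.log n := Real.log_pos (by linarith)
  have hll : Real.log (Real.log n) ≤ (m + 33) * Real.log A := by
    have := Real.log_le_log hlogn0 hlogn
    rw [Real.log_pow] at this
    exact_mod_cast this
  have hlogA := Real.log_nonneg hA1
  have hMP := (mertensProd_pos (A ^ m)).le
  rw [div_le_iff₀ hn0']
  calc (Nat.totient (usigma n) : ℝ) * Real.log (Real.log n)
      ≤ Nat.totient (usigma n) * ((m + 33) * Real.log A) := by gcongr
    _ ≤ n * Real.exp (1 / A ^ m) * mertensProd (A ^ m) * ((m + 33) * Real.log A) := by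
      gcongr
      exact htot.trans (by gcongr)
    _ = _ := by ring

theorem frequently_totient_usigma_le {c : ℝ}
    (hc : Real.exp (-Real.eulerMascheroniConstant) < c) :
    ∃ᶠ n : ℕ in atTop, (Nat.totient (usigma n) : ℝ) * Real.log (Real.log n) / n ≤ c := by
  set e := Real.exp (-Real.eulerMascheroniConstant) with he
  have hm : ∀ᶠ m : ℕ in atTop, e * (1 + 33 / m) < c := by
    have h : Tendsto (fun m : ℕ => e * (1 + 33 / (m : ℝ))) atTop (nhds (e * (1 + 0))) :=
      (tendsto_const_nhds.add
        (tendsto_const_nhds.div_atTop tendsto_natCast_atTop_atTop)).const_mul _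
    rw [add_zero, mul_one] at h
    exact h.eventually_lt_const hc
  obtain ⟨m, hmc, hm32⟩ := (hm.and (eventually_ge_atTop 32)).exists
  have hm0 : (m : ℝ) ≠ 0 := by
    have : m ≠ 0 := by omega
    exact_mod_cast this
  have hpow : Tendsto (fun A : ℝ => A ^ m) atTop atTop := tendsto_pow_atTop (by omega)
  have hlim : Tendsto (fun A : ℝ =>
      Real.exp (1 / A ^ m) * mertensProd (A ^ m) * ((m + 33) * Real.log A)) atTop
      (nhds (e * (1 + 33 / m))) := by
    have h1 : Tendsto (fun A : ℝ => Real.exp (1 / A ^ m)) atTop (nhds 1) := by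
      have := (Real.continuous_exp.tendsto 0).comp
        ((tendsto_const_nhds (x := (1 : ℝ))).div_atTop hpow)
      rwa [Real.exp_zero] at this
    have h2 := tendsto_prod_one_sub_primesLE_mul_log.comp hpow
    have h3 := (h1.mul h2).mul_const (1 + 33 / (m : ℝ))
    rw [one_mul] at h3
    refine h3.congr fun A => ?_
    simp only [Function.comp_apply, mertensProd, Real.log_pow]
    field_simp
  rw [frequently_atTop]
  intro a
  obtain ⟨A, ⟨⟨n, hAn, hn⟩, hlt⟩, haA⟩ := (((exists_totient_usigma_le hm32).and
    (hlim.eventually_lt_const hmc)).and (eventually_ge_atTop (a : ℝ))).exists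
  exact ⟨n, by exact_mod_cast haA.trans hAn, hn.trans hlt.le⟩

theorem liminf_phi_usigma :
    liminf (fun n : ℕ => (Nat.totient (usigma n) : ℝ) * Real.log (Real.log n) / n) atTop
      = Real.exp (-Real.eulerMascheroniConstant) := by
  have hbdd : IsBoundedUnder (· ≥ ·) atTop
      (fun n : ℕ => (Nat.totient (usigma n) : ℝ) * Real.log (Real.log n) / n) :=
    isBoundedUnder_of_eventually_ge (eventually_le_totient_usigma (c := 0) (Real.exp_pos _))
  have hcobdd : IsCoboundedUnder (· ≥ ·) atTop
      (fun n : ℕ => (Nat.totient (usigma n) : ℝ) * Real.log (Real.log n) / n) :=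
    IsCoboundedUnder.of_frequently_le (frequently_totient_usigma_le (lt_add_one _))
  refine le_antisymm (le_of_forall_gt fun c hc => ?_) (le_of_forall_lt fun c hc => ?_)
  · obtain ⟨d, hd1, hd2⟩ := exists_between hc
    exact (liminf_le_of_frequently_le (frequently_totient_usigma_le hd1) hbdd).trans_lt hd2
  · obtain ⟨d, hd1, hd2⟩ := exists_between hc
    exact hd1.trans_le (le_liminf_of_le hcobdd (eventually_le_totient_usigma hd2))
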